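/- arXiv:2312.06650 — 4 statements merged into one kernel-verified Lean document; each statement's English description precedes it below -/
import Mathlib

section
/- Let d ≥ 1 be an integer, k, s ∈ ℕ, and δ > 0. There exists a threshold p_0 depending only on δ, d and k such that for every prime p ≥ p_0 the following holds. Let H ⊆ 𝔽_p^d with |H| > δ·p^d, let M : 𝔽_p^d → 𝔽_p be a non-degenerate quadratic form, and let U_1, …, U_k, V be subspaces of 𝔽_p^d with U_1, …, U_k all of the same dimension such that the pair (U_i, V) is linearly independent for each 1 ≤ i ≤ k; set U_0 := {0}. Let F : 𝔽_p^d → HP_d(s) satisfy F(x) − F(y) ∈ J^M_{span{x,y}+V} for all x, y ∈ H such that the tuple (x, y, U_i, V) is linearly independent for every 0 ≤ i ≤ k. If d ≥ s + dim(U_k) + 2·dim(V) + 8 (with dim(U_k) interpreted as 0 when k = 0), then there exists G ∈ HP_d(s) such that F(x) − G ∈ J^M_{span{x}+V} for every x ∈ H such that the tuple (x, U_i, V) is linearly independent for every 0 ≤ i ≤ k. -/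
noncomputable section

open MvPolynomial

/-- The quadratic polynomial `n ↦ (nA)·n`. -/
def quadPoly (p d : ℕ) (A : Matrix (Fin d) (Fin d) (ZMod p)) :
    MvPolynomial (Fin d) (ZMod p) :=
  ∑ i : Fin d, ∑ j : Fin d, MvPolynomial.C (A i j) * (MvPolynomial.X i * MvPolynomial.X j)

/-- The linear polynomial `n ↦ (hA)·n`. -/
def linPoly (p d : ℕ) (A : Matrix (Fin d) (Fin d) (ZMod p)) (h : Fin d → ZMod p) :
    MvPolynomial (Fin d) (ZMod p) :=
  ∑ j : Fin d, MvPolynomial.C (∑ i : Fin d, h i * A i j) * MvPolynomial.X j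

/-- The ideal `J^M_V` attached to the quadratic form with associated matrix `A` and the
set of vectors `V`: it is generated by `n ↦ (nA)·n` and `n ↦ (hA)·n` for `h ∈ V`. -/
def JM (p d : ℕ) (A : Matrix (Fin d) (Fin d) (ZMod p)) (V : Set (Fin d → ZMod p)) :
    Ideal (MvPolynomial (Fin d) (ZMod p)) :=
  Ideal.span ({quadPoly p d A} ∪ (linPoly p d A '' V))

/-- `M` is the quadratic form `n ↦ (nA)·n + n·u + v` with `A` symmetric. -/
def IsQuadFormWith (p d : ℕ) (M : (Fin d → ZMod p) → ZMod p)
    (A : Matrix (Fin d) (Fin d) (ZMod p)) (u : Fin d → ZMod p) (v : ZMod p) : Prop :=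
  A.IsSymm ∧ ∀ n : Fin d → ZMod p,
    M n = (∑ j : Fin d, (∑ i : Fin d, n i * A i j) * n j) + (∑ i : Fin d, n i * u i) + v

/-- The tuple `(h 0, …, h (m-1), U, V)` of vectors and two subspaces of `𝔽_p^d` is
linearly independent. -/
def VecSubIndep (p d : ℕ) {m : ℕ} (h : Fin m → (Fin d → ZMod p))
    (U V : Submodule (ZMod p) (Fin d → ZMod p)) : Prop :=
  ∀ (c : Fin m → ZMod p), ∀ u ∈ U, ∀ w ∈ V,
    (∑ ℓ, c ℓ • h ℓ) + u + w = 0 → (∀ ℓ, c ℓ = 0) ∧ u = 0 ∧ w = 0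

section helpers
variable {p d : ℕ}

lemma hlin_add (A : Matrix (Fin d) (Fin d) (ZMod p)) (g h : Fin d → ZMod p) :
    linPoly p d A (g + h) = linPoly p d A g + linPoly p d A h := by
  simp only [linPoly, ← Finset.sum_add_distrib, ← add_mul, ← C_add, Pi.add_apply]

lemma hlin_smul (A : Matrix (Fin d) (Fin d) (ZMod p)) (c : ZMod p) (h : Fin d → ZMod p) :
    linPoly p d A (c • h) = C c * linPoly p d A h := by
  simp only [linPoly, Finset.mul_sum, ← mul_assoc, ← C_mul, Pi.smul_apply, smul_eq_mul]

lemma hlin_homog (A : Matrix (Fin d) (Fin d) (ZMod p)) (h : Fin d → ZMod p) :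
    (linPoly p d A h).IsHomogeneous 1 := by
  refine IsHomogeneous.sum _ _ _ fun j _ => ?_
  have := (isHomogeneous_C (Fin d) (∑ i : Fin d, h i * A i j)).mul (isHomogeneous_X (ZMod p) j)
  rwa [zero_add] at this

lemma hquad_homog (A : Matrix (Fin d) (Fin d) (ZMod p)) :
    (quadPoly p d A).IsHomogeneous 2 := by
  refine IsHomogeneous.sum _ _ _ fun i _ => IsHomogeneous.sum _ _ _ fun j _ => ?_
  have := (isHomogeneous_C (Fin d) (A i j)).mul
    ((isHomogeneous_X (ZMod p) i).mul (isHomogeneous_X (ZMod p) j))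
  rwa [zero_add] at this

/-- ideal generated by the linear forms only -/
def hI (A : Matrix (Fin d) (Fin d) (ZMod p)) (W : Submodule (ZMod p) (Fin d → ZMod p)) :
    Ideal (MvPolynomial (Fin d) (ZMod p)) :=
  Ideal.span (linPoly p d A '' (W : Set (Fin d → ZMod p)))

lemma hJ_eq (A : Matrix (Fin d) (Fin d) (ZMod p)) (W : Submodule (ZMod p) (Fin d → ZMod p)) :
    JM p d A W = Ideal.span {quadPoly p d A} ⊔ hI A W := by
  rw [JM, Ideal.span_union, hI]

lemma hJ_mono (A : Matrix (Fin d) (Fin d) (ZMod p)) {W W' : Submodule (ZMod p) (Fin d → ZMod p)}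
    (h : W ≤ W') : JM p d A W ≤ JM p d A W' :=
  Ideal.span_mono (Set.union_subset_union_right _ (Set.image_mono h))

lemma hJ_mem (A : Matrix (Fin d) (Fin d) (ZMod p)) {W : Submodule (ZMod p) (Fin d → ZMod p)}
    {h : Fin d → ZMod p} (hh : h ∈ W) : linPoly p d A h ∈ JM p d A W :=
  Ideal.subset_span (Or.inr ⟨h, hh, rfl⟩)

lemma hI_sup (A : Matrix (Fin d) (Fin d) (ZMod p)) (W : Submodule (ZMod p) (Fin d → ZMod p))
    (h : Fin d → ZMod p) :
    hI A (W ⊔ Submodule.span (ZMod p) {h}) ≤ hI A W ⊔ Ideal.span {linPoly p d A h} := by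
  refine Ideal.span_le.2 ?_
  rintro _ ⟨w, hw, rfl⟩
  obtain ⟨a, ha, b, hb, rfl⟩ := Submodule.mem_sup.1 hw
  obtain ⟨c, rfl⟩ := Submodule.mem_span_singleton.1 hb
  rw [hlin_add, hlin_smul]
  exact Submodule.add_mem_sup (Ideal.subset_span ⟨a, ha, rfl⟩)
    (Ideal.mul_mem_left _ _ (Ideal.subset_span rfl))

lemma hJ_sup (A : Matrix (Fin d) (Fin d) (ZMod p)) (W : Submodule (ZMod p) (Fin d → ZMod p))
    (h : Fin d → ZMod p) :
    JM p d A ((W ⊔ Submodule.span (ZMod p) {h} : Submodule _ _) : Set (Fin d → ZMod p)) ≤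
      JM p d A W ⊔ Ideal.span {linPoly p d A h} := by
  rw [hJ_eq, hJ_eq, sup_assoc]
  exact sup_le_sup_left (hI_sup A W h) _

lemma hJ_comp (A : Matrix (Fin d) (Fin d) (ZMod p)) (W : Set (Fin d → ZMod p))
    {P : MvPolynomial (Fin d) (ZMod p)} (hP : P ∈ JM p d A W) (n : ℕ) :
    homogeneousComponent n P ∈ JM p d A W := by
  let _ : GradedAlgebra (homogeneousSubmodule (Fin d) (ZMod p)) := MvPolynomial.gradedAlgebra
  refine homogeneousComponent_mem_of_mem ?_ hP n
  refine Ideal.homogeneous_span _ _ ?_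
  rintro _ (rfl | ⟨w, _, rfl⟩)
  · exact ⟨2, hquad_homog A⟩
  · exact ⟨1, hlin_homog A w⟩

lemma hJ_deg0 (A : Matrix (Fin d) (Fin d) (ZMod p)) (W : Set (Fin d → ZMod p))
    {P : MvPolynomial (Fin d) (ZMod p)} (hP : P ∈ JM p d A W) (h0 : P.IsHomogeneous 0) :
    P = 0 := by
  have h1 : P = C (coeff 0 P) := by
    exact (totalDegree_eq_zero_iff_eq_C).1 (Nat.le_zero.1 h0.totalDegree_le)
  have h2 : JM p d A W ≤ RingHom.ker (constantCoeff (R := ZMod p) (σ := Fin d)) := by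
    refine Ideal.span_le.2 ?_
    rintro _ (rfl | ⟨w, _, rfl⟩)
    · simp [quadPoly, RingHom.mem_ker]
    · simp [linPoly, RingHom.mem_ker]
  have h3 := h2 hP
  rw [RingHom.mem_ker, constantCoeff_eq] at h3
  rw [h1, h3, C_0]

lemma hJ_split (A : Matrix (Fin d) (Fin d) (ZMod p)) (W : Submodule (ZMod p) (Fin d → ZMod p))
    (h : Fin d → ZMod p) {s : ℕ} {P : MvPolynomial (Fin d) (ZMod p)}
    (hP : P.IsHomogeneous (s+1))
    (hm : P ∈ JM p d A ((W ⊔ Submodule.span (ZMod p) {h} : Submodule _ _) :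
      Set (Fin d → ZMod p))) :
    ∃ R : MvPolynomial (Fin d) (ZMod p), R.IsHomogeneous s ∧
      P - linPoly p d A h * R ∈ JM p d A W := by
  obtain ⟨a, ha, b, hb, rfl⟩ := Submodule.mem_sup.1 (hJ_sup A W h hm)
  obtain ⟨R, rfl⟩ := Ideal.mem_span_singleton'.1 hb
  refine ⟨homogeneousComponent s R, homogeneousComponent_isHomogeneous _ _, ?_⟩
  have h1 := hJ_comp A W ha (s+1)
  have h2 : homogeneousComponent (s+1) (R * linPoly p d A h)
      = linPoly p d A h * homogeneousComponent s R := by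
    have e : ∑ i ∈ Finset.range (R.totalDegree + 1), homogeneousComponent i R = R :=
      sum_homogeneousComponent R
    have e2 : ∀ i, homogeneousComponent (s+1) (homogeneousComponent i R * linPoly p d A h) =
        if i = s then homogeneousComponent s R * linPoly p d A h else 0 := fun i => by
      rw [homogeneousComponent_of_mem
        ((homogeneousComponent_isHomogeneous i R).mul (hlin_homog A h))]
      by_cases hi : i = s
      · subst hi; simp
      · rw [if_neg hi, if_neg (by omega)]
    conv_lhs => rw [← e, Finset.sum_mul, map_sum]
    simp_rw [e2]
    rw [Finset.sum_ite_eq', mul_comm]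
    split_ifs with hs
    · rfl
    · rw [homogeneousComponent_eq_zero _ _ (by simpa using hs), mul_zero]
  have h3 : homogeneousComponent (s+1) (a + R * linPoly p d A h) = a + R * linPoly p d A h := by
    rw [homogeneousComponent_of_mem hP, if_pos rfl]
  rw [← h3, map_add, h2, add_sub_cancel_right]
  exact h1

variable [Fact p.Prime]

lemma hI_ker (A : Matrix (Fin d) (Fin d) (ZMod p)) (hA : A.det ≠ 0)
    (W : Submodule (ZMod p) (Fin d → ZMod p)) :
    (hI A W).IsPrime ∧ ∀ h, linPoly p d A h ∈ hI A W → h ∈ W := by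
  set L : Submodule (ZMod p) (Fin d → ZMod p) := W.map (Matrix.vecMulLinear A) with hL
  have hlin : ∀ h, linPoly p d A h = ∑ j, C (Matrix.vecMul h A j) * X j := fun h => by
    simp [linPoly, Matrix.vecMul, dotProduct]
  obtain ⟨L', hc⟩ := Submodule.exists_isCompl L
  set π : (Fin d → ZMod p) →ₗ[ZMod p] (Fin d → ZMod p) := L'.projection L hc.symm with hπ
  have hk : ∀ v, π v = 0 ↔ v ∈ L := fun v => by
    rw [hπ, Submodule.projection_apply_eq_zero_iff]
  have hsub : ∀ v, v - π v ∈ L := fun v => by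
    rw [hπ, ← Submodule.projection_eq_self_sub_projection]
    exact Submodule.projection_apply_mem _ _
  let lin : (Fin d → ZMod p) → MvPolynomial (Fin d) (ZMod p) := fun v => ∑ j, C (v j) * X j
  have lin_inj : ∀ v, lin v = 0 → v = 0 := fun v hv => by
    ext j
    have := congrArg (coeff (Finsupp.single j 1)) hv
    simpa [lin, coeff_sum, coeff_C_mul, coeff_X, Finsupp.single_left_inj] using this
  have hLI : ∀ v ∈ L, lin v ∈ hI A W := by
    rintro _ ⟨w, hw, rfl⟩
    refine Ideal.subset_span ⟨w, hw, ?_⟩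
    simp [hlin, lin]
  let φ : MvPolynomial (Fin d) (ZMod p) →ₐ[ZMod p] MvPolynomial (Fin d) (ZMod p) :=
    aeval fun j => lin (π (Pi.single j 1))
  have hφ : ∀ v, φ (lin v) = lin (π v) := fun v => by
    have : v = ∑ j, v j • (Pi.single j 1 : Fin d → ZMod p) := by
      ext i; simp [Finset.sum_apply, Pi.single_apply]
    conv_rhs => rw [this]
    simp only [lin, φ, map_sum, map_mul, map_smul, aeval_X, algHom_C, algebraMap_eq,
      Finset.sum_apply, Pi.smul_apply, smul_eq_mul, Finset.mul_sum, Finset.sum_mul]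
    rw [Finset.sum_comm]
    simp [mul_assoc]
  have hφI : ∀ P, P - φ P ∈ hI A W := fun P => by
    induction P using MvPolynomial.induction_on with
    | C a => simp [φ]
    | add P Q hP hQ =>
      rw [map_add, add_sub_add_comm]; exact add_mem hP hQ
    | mul_X P j hP =>
      have : X j - φ (X j) ∈ hI A W := by
        have h1 := hLI _ (hsub (Pi.single j 1))
        have h2 : lin (Pi.single j 1 - π (Pi.single j 1)) = X j - φ (X j) := by
          simp [lin, φ, sub_mul, Finset.sum_sub_distrib, Pi.single_apply]
        rwa [h2] at h1
      have e : P * X j - φ (P * X j) = (P - φ P) * X j + φ P * (X j - φ (X j)) := by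
        rw [map_mul]; ring
      rw [e]
      exact add_mem (Ideal.mul_mem_right _ _ hP) (Ideal.mul_mem_left _ _ this)
  have hker : hI A W = RingHom.ker φ := by
    apply le_antisymm
    · refine Ideal.span_le.2 ?_
      rintro _ ⟨w, hw, rfl⟩
      change φ _ = 0
      rw [hlin]
      change φ (lin _) = 0
      rw [hφ, show π (Matrix.vecMul w A) = 0 from (hk _).2 ⟨w, hw, rfl⟩]
      simp [lin]
    · intro P hP
      have := hφI P
      rwa [show φ P = 0 from hP, sub_zero] at this
  refine ⟨hker ▸ RingHom.ker_isPrime _, fun h hh => ?_⟩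
  rw [hker] at hh
  have h1 : φ (lin (Matrix.vecMul h A)) = 0 := by
    have h2 : φ (linPoly p d A h) = 0 := hh
    rwa [hlin] at h2
  rw [hφ] at h1
  obtain ⟨w, hw, e⟩ := (hk _).1 (lin_inj _ h1)
  have : w = h := by
    have hinj := Matrix.vecMul_injective_of_isUnit
      ((Matrix.isUnit_iff_isUnit_det A).2 (isUnit_iff_ne_zero.2 hA))
    exact hinj e
  exact this ▸ hw

lemma hq_notmem (h2 : (2 : ZMod p) ≠ 0) (A : Matrix (Fin d) (Fin d) (ZMod p)) (hA : A.det ≠ 0)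
    (hS : A.IsSymm) (W : Submodule (ZMod p) (Fin d → ZMod p))
    (hW : 2 * Module.finrank (ZMod p) W < d) : quadPoly p d A ∉ hI A W := by
  intro hq
  set B : LinearMap.BilinForm (ZMod p) (Fin d → ZMod p) := Matrix.toBilin' A with hB
  have hBn : B.Nondegenerate := Matrix.nondegenerate_toBilin'_iff.2
    (Matrix.nondegenerate_of_det_ne_zero hA)
  have hBs : B.IsSymm := Matrix.isSymm_toBilin'_iff_isSymm.2 hS
  have hBlin : ∀ w n, eval n (linPoly p d A w) = B w n := fun w n => by
    simp [linPoly, hB, Matrix.toBilin'_apply, Finset.sum_mul]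
    rw [Finset.sum_comm]
  have hBq : ∀ n, eval n (quadPoly p d A) = B n n := fun n => by
    simp [quadPoly, hB, Matrix.toBilin'_apply]
    refine Finset.sum_congr rfl fun i _ => Finset.sum_congr rfl fun j _ => by ring
  have hz : ∀ n ∈ B.orthogonal W, B n n = 0 := fun n hn => by
    have hle : hI A W ≤ RingHom.ker (eval n) := by
      refine Ideal.span_le.2 ?_
      rintro _ ⟨w, hw, rfl⟩
      change eval n _ = 0
      rw [hBlin]
      exact hn w hw
    rw [← hBq]; exact hle hq
  have hle : B.orthogonal W ≤ B.orthogonal (B.orthogonal W) := fun n hn m hm => by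
    have e1 := hz _ (add_mem hn hm)
    have e2 := hz _ hn
    have e3 := hz _ hm
    have e4 : B n m = B m n := hBs.eq n m
    simp only [map_add, LinearMap.add_apply, e2, e3, e4] at e1
    have : 2 * B m n = 0 := by linear_combination e1
    exact (mul_eq_zero.1 this).resolve_left h2
  have f1 := Submodule.finrank_mono hle
  have f2 := LinearMap.BilinForm.finrank_orthogonal hBn W
  have f3 := LinearMap.BilinForm.finrank_orthogonal hBn (B.orthogonal W)
  simp only [Module.finrank_fin_fun] at f2 f3
  omega

lemma hfin (W : Submodule (ZMod p) (Fin d → ZMod p)) (h : Fin d → ZMod p) :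
    Module.finrank (ZMod p) (W ⊔ Submodule.span (ZMod p) {h} : Submodule _ _) ≤
      Module.finrank (ZMod p) W + 1 :=
  (Submodule.finrank_add_le_finrank_add_finrank _ _).trans
    (Nat.add_le_add_left (by simpa using finrank_span_le_card (R := ZMod p) {h}) _)

lemma hnzd (h2 : (2 : ZMod p) ≠ 0) (A : Matrix (Fin d) (Fin d) (ZMod p)) (hA : A.det ≠ 0)
    (hS : A.IsSymm) (W : Submodule (ZMod p) (Fin d → ZMod p))
    (hW : 2 * Module.finrank (ZMod p) W + 2 < d) (h : Fin d → ZMod p) (hh : h ∉ W)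
    {P : MvPolynomial (Fin d) (ZMod p)} (hP : linPoly p d A h * P ∈ JM p d A W) :
    P ∈ JM p d A W := by
  rw [hJ_eq] at hP ⊢
  obtain ⟨a, ha, b, hb, e⟩ := Submodule.mem_sup.1 hP
  obtain ⟨R, rfl⟩ := Ideal.mem_span_singleton'.1 ha
  set W' := W ⊔ Submodule.span (ZMod p) {h} with hW'
  have hf : Module.finrank (ZMod p) W' ≤ _ := hfin W h
  have hWW : hI A W ≤ hI A W' := Ideal.span_mono (Set.image_mono (le_sup_left : W ≤ W'))
  have hh' : linPoly p d A h ∈ hI A W' := Ideal.subset_span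
    ⟨h, (le_sup_right : _ ≤ W') (Submodule.mem_span_singleton_self h), rfl⟩
  have hR : R * quadPoly p d A ∈ hI A W' := by
    have : R * quadPoly p d A = linPoly p d A h * P - b := by rw [← e]; ring
    rw [this]
    exact sub_mem (Ideal.mul_mem_right _ _ hh') (hWW hb)
  have hR' := ((hI_ker A hA W').1.mem_or_mem hR).resolve_right
    (hq_notmem h2 A hA hS W' (by omega))
  obtain ⟨i, hi, j, hj, rfl⟩ := Submodule.mem_sup.1 (hI_sup A W h hR')
  obtain ⟨R', rfl⟩ := Ideal.mem_span_singleton'.1 hj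
  have h3 : linPoly p d A h * (P - R' * quadPoly p d A) ∈ hI A W := by
    have : linPoly p d A h * (P - R' * quadPoly p d A) = i * quadPoly p d A + b := by
      rw [mul_sub, ← e]; ring
    rw [this]
    exact add_mem (Ideal.mul_mem_right _ _ hi) hb
  have h4 := ((hI_ker A hA W).1.mem_or_mem h3).resolve_left fun h5 => hh ((hI_ker A hA W).2 h h5)
  have : P = R' * quadPoly p d A + (P - R' * quadPoly p d A) := by ring
  rw [this]
  exact Submodule.add_mem_sup (Ideal.mul_mem_left _ _ (Ideal.subset_span rfl)) h4

lemma hcard (W : Submodule (ZMod p) (Fin d → ZMod p)) (hW : Module.finrank (ZMod p) W + 1 ≤ d)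
    (Y : Finset (Fin d → ZMod p)) (hY : ∀ y ∈ Y, y ∈ W) : Y.card ≤ p ^ (d - 1) := by
  classical
  have h1 : Nat.card W = p ^ Module.finrank (ZMod p) W := by
    rw [Module.natCard_eq_pow_finrank (K := ZMod p), Nat.card_zmod]
  have h2 : Y.card ≤ Nat.card W := by
    rw [← Nat.card_eq_finsetCard]
    exact Nat.card_le_card_of_injective (fun y : Y => (⟨y.1, hY y.1 y.2⟩ : W))
      fun a b hab => Subtype.ext (congrArg (fun z : W => z.1) hab)
  rw [h1] at h2
  exact h2.trans (Nat.pow_le_pow_right (Fact.out : p.Prime).pos (by omega))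

open Classical in
lemma hcard' {m : ℕ} (T : Fin m → Submodule (ZMod p) (Fin d → ZMod p))
    (hT : ∀ i, Module.finrank (ZMod p) (T i) + 1 ≤ d) (Y : Finset (Fin d → ZMod p)) :
    Y.card ≤ (Y.filter fun y => ∀ i, y ∉ T i).card + m * p ^ (d - 1) := by
  have h1 : Y ⊆ (Y.filter fun y => ∀ i, y ∉ T i) ∪
      Finset.univ.biUnion fun i => Y.filter fun y => y ∈ T i := by
    intro y hy
    by_cases h : ∀ i, y ∉ T i
    · exact Finset.mem_union_left _ (Finset.mem_filter.2 ⟨hy, h⟩)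
    · push Not at h
      obtain ⟨i, hi⟩ := h
      exact Finset.mem_union_right _ (Finset.mem_biUnion.2
        ⟨i, Finset.mem_univ _, Finset.mem_filter.2 ⟨hy, hi⟩⟩)
  refine (Finset.card_le_card h1).trans ((Finset.card_union_le _ _).trans
    (Nat.add_le_add_left (Finset.card_biUnion_le.trans ?_) _))
  refine (Finset.sum_le_sum fun i _ => hcard (T i) (hT i) _
    fun y hy => (Finset.mem_filter.1 hy).2).trans ?_
  simp

open Classical in
lemma hext (h2 : (2 : ZMod p) ≠ 0) (A : Matrix (Fin d) (Fin d) (ZMod p)) (hA : A.det ≠ 0)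
    (hS : A.IsSymm) (W : Submodule (ZMod p) (Fin d → ZMod p))
    (hW : 2 * Module.finrank (ZMod p) W + 4 < d) (t : ℕ) :
    ∀ (P : MvPolynomial (Fin d) (ZMod p)), P.IsHomogeneous t →
    ∀ Y : Finset (Fin d → ZMod p), (t + 1) * p ^ (d - 1) < Y.card →
      (∀ y ∈ Y, P ∈ JM p d A ((W ⊔ Submodule.span (ZMod p) {y} : Submodule _ _) :
        Set (Fin d → ZMod p))) → P ∈ JM p d A W := by
  induction t with
  | zero =>
    intro P hP Y hY h
    obtain ⟨y, hy⟩ : Y.Nonempty := Finset.card_pos.1 (by omega)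
    rw [hJ_deg0 A _ (h y hy) hP]
    exact zero_mem _
  | succ t ih =>
    intro P hP Y hY h
    obtain ⟨y, hy⟩ : Y.Nonempty := Finset.card_pos.1 (by omega)
    by_cases hyW : y ∈ W
    · have := h y hy
      rwa [sup_eq_left.2 ((Submodule.span_singleton_le_iff_mem y W).2 hyW)] at this
    obtain ⟨R, hR, hPR⟩ := hJ_split A W y hP (h y hy)
    have hf := hfin W y
    have hc := hcard' (fun _ : Fin 1 => W ⊔ Submodule.span (ZMod p) {y}) (fun _ => by omega) Y
    have hRW : R ∈ JM p d A W := by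
      refine ih R hR (Y.filter fun z => ∀ _ : Fin 1, z ∉ W ⊔ Submodule.span (ZMod p) {y}) ?_ ?_
      · have : (t + 1 + 1) * p ^ (d-1) = (t+1) * p ^ (d-1) + 1 * p ^ (d-1) := by ring
        omega
      · intro z hz
        obtain ⟨hzY, hz⟩ := Finset.mem_filter.1 hz
        have hz := hz 0
        have hfz := hfin W z
        refine hnzd h2 A hA hS _ (by omega) y ?_ ?_
        · intro hy'
          obtain ⟨a, ha, b, hb, e⟩ := Submodule.mem_sup.1 hy'
          obtain ⟨c, rfl⟩ := Submodule.mem_span_singleton.1 hb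
          by_cases hc0 : c = 0
          · subst hc0
            apply hyW; rw [← e]; simpa using ha
          · apply hz
            have : z = c⁻¹ • (y - a) := by
              rw [← e, add_sub_cancel_left, smul_smul, inv_mul_cancel₀ hc0, one_smul]
            rw [this]
            exact Submodule.smul_mem _ _ (sub_mem
              (Submodule.mem_sup_right (Submodule.mem_span_singleton_self y))
              (Submodule.mem_sup_left ha))
        · have h3 := sub_mem (h z hzY) (hJ_mono A (le_sup_left :
            W ≤ W ⊔ Submodule.span (ZMod p) {z}) hPR)
          rwa [sub_sub_cancel] at h3
    have := add_mem hPR (Ideal.mul_mem_left _ (linPoly p d A y) hRW)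
    rwa [sub_add_cancel] at this


lemma hspan (x y : Fin d → ZMod p) (V : Submodule (ZMod p) (Fin d → ZMod p)) :
    Submodule.span (ZMod p) {x, y} ⊔ V =
      (Submodule.span (ZMod p) {x} ⊔ V) ⊔ Submodule.span (ZMod p) {y} := by
  rw [Submodule.span_insert, sup_right_comm]

lemma hexch {T : Submodule (ZMod p) (Fin d → ZMod p)} {x y : Fin d → ZMod p}
    (hx : x ∉ T) (h : x ∈ T ⊔ Submodule.span (ZMod p) {y}) :
    y ∈ T ⊔ Submodule.span (ZMod p) {x} := by
  obtain ⟨a, ha, b, hb, e⟩ := Submodule.mem_sup.1 h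
  obtain ⟨c, rfl⟩ := Submodule.mem_span_singleton.1 hb
  by_cases hc0 : c = 0
  · subst hc0
    exact absurd (by rw [← e]; simpa using ha) hx
  · have : y = c⁻¹ • (x - a) := by
      rw [← e, add_sub_cancel_left, smul_smul, inv_mul_cancel₀ hc0, one_smul]
    rw [this]
    exact Submodule.smul_mem _ _ (sub_mem
      (Submodule.mem_sup_right (Submodule.mem_span_singleton_self x))
      (Submodule.mem_sup_left ha))

/-- from generic `G` to all `x` -/
lemma hextend (h2 : (2 : ZMod p) ≠ 0) (A : Matrix (Fin d) (Fin d) (ZMod p)) (hA : A.det ≠ 0)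
    (hS : A.IsSymm) (V : Submodule (ZMod p) (Fin d → ZMod p))
    (hV : 2 * Module.finrank (ZMod p) V + 8 ≤ d) {m : ℕ} 
    (T : Fin m → Submodule (ZMod p) (Fin d → ZMod p)) (t s : ℕ)
    (ht : ∀ i, Module.finrank (ZMod p) (T i) + 2 ≤ d)
    (H : Finset (Fin d → ZMod p)) (hH : (2 * m + s + 1) * p ^ (d - 1) < H.card)
    (F : (Fin d → ZMod p) → MvPolynomial (Fin d) (ZMod p)) (hF : ∀ x, (F x).IsHomogeneous s)
    (hFJ : ∀ x ∈ H, ∀ y ∈ H, (∀ i, x ∉ T i ∧ y ∉ T i ⊔ Submodule.span (ZMod p) {x}) →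
      F x - F y ∈ JM p d A ((Submodule.span (ZMod p) {x, y} ⊔ V : Submodule _ _) :
        Set (Fin d → ZMod p)))
    (G : MvPolynomial (Fin d) (ZMod p)) (hG : G.IsHomogeneous s) (y₁ : Fin d → ZMod p)
    (hGJ : ∀ x ∈ H, (∀ i, x ∉ T i ⊔ Submodule.span (ZMod p) {y₁}) →
      F x - G ∈ JM p d A ((Submodule.span (ZMod p) {x} ⊔ V : Submodule _ _) :
        Set (Fin d → ZMod p))) (x : Fin d → ZMod p) (hx : x ∈ H) (hxT : ∀ i, x ∉ T i) :
    F x - G ∈ JM p d A ((Submodule.span (ZMod p) {x} ⊔ V : Submodule _ _) :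
        Set (Fin d → ZMod p)) := by
  classical
  have c1 := hcard' (fun i => T i ⊔ Submodule.span (ZMod p) {x})
    (fun i => by have := hfin (T i) x; have := ht i; omega) H
  set Y1 := H.filter fun y => ∀ i, y ∉ T i ⊔ Submodule.span (ZMod p) {x}
  have c2 := hcard' (fun i => T i ⊔ Submodule.span (ZMod p) {y₁})
    (fun i => by have := hfin (T i) y₁; have := ht i; omega) Y1
  set Y2 := Y1.filter fun y => ∀ i, y ∉ T i ⊔ Submodule.span (ZMod p) {y₁}
  have hf := hfin V x
  rw [sup_comm] at hf
  refine hext h2 A hA hS _ (by omega) s _ ((hF x).sub hG) Y2 ?_ ?_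
  · have : (2 * m + s + 1) * p ^ (d - 1) = (s+1) * p ^ (d - 1) + m * p ^ (d-1) + m * p ^ (d-1) := by
      ring
    omega
  · intro y hy
    obtain ⟨hy, hy2⟩ := Finset.mem_filter.1 hy
    obtain ⟨hyH, hy1⟩ := Finset.mem_filter.1 hy
    have e1 := hFJ x hx y hyH fun i => ⟨hxT i, hy1 i⟩
    have e2 := hGJ y hyH hy2
    rw [hspan] at e1
    have e3 := hJ_mono A (show Submodule.span (ZMod p) {y} ⊔ V ≤
      (Submodule.span (ZMod p) {x} ⊔ V) ⊔ Submodule.span (ZMod p) {y} from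
      sup_le le_sup_right (le_sup_right.trans le_sup_left)) e2
    have := add_mem e1 e3
    rwa [sub_add_sub_cancel] at this

lemma hmain (h2 : (2 : ZMod p) ≠ 0) (A : Matrix (Fin d) (Fin d) (ZMod p)) (hA : A.det ≠ 0)
    (hS : A.IsSymm) (V : Submodule (ZMod p) (Fin d → ZMod p))
    (hV : 2 * Module.finrank (ZMod p) V + 8 ≤ d) {m : ℕ} (hm : 0 < m)
    (H : Finset (Fin d → ZMod p)) (s : ℕ) :
    ∀ (T : Fin m → Submodule (ZMod p) (Fin d → ZMod p)),
    (∀ i, V ≤ T i) → (∀ i, Module.finrank (ZMod p) (T i) + s + 2 ≤ d) →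
    (2 * m + s + 1) * p ^ (d - 1) < H.card →
    ∀ F : (Fin d → ZMod p) → MvPolynomial (Fin d) (ZMod p), (∀ x, (F x).IsHomogeneous s) →
    (∀ x ∈ H, ∀ y ∈ H, (∀ i, x ∉ T i ∧ y ∉ T i ⊔ Submodule.span (ZMod p) {x}) →
      F x - F y ∈ JM p d A ((Submodule.span (ZMod p) {x, y} ⊔ V : Submodule _ _) :
        Set (Fin d → ZMod p))) →
    ∃ G : MvPolynomial (Fin d) (ZMod p), G.IsHomogeneous s ∧ ∀ x ∈ H, (∀ i, x ∉ T i) →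
      F x - G ∈ JM p d A ((Submodule.span (ZMod p) {x} ⊔ V : Submodule _ _) :
        Set (Fin d → ZMod p)) := by
  classical
  induction s with
  | zero =>
    intro T hVT ht hH F hF hFJ
    have c1 := hcard' T (fun i => by have := ht i; omega) H
    obtain ⟨y₁, hy₁⟩ : (H.filter fun y => ∀ i, y ∉ T i).Nonempty := by
      have : (2 * m + 0 + 1) * p ^ (d - 1) = m * p ^ (d-1) + m * p ^ (d-1) + p ^ (d-1) := by ring
      exact Finset.card_pos.1 (by omega)
    obtain ⟨hyH, hyT⟩ := Finset.mem_filter.1 hy₁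
    refine ⟨F y₁, hF _, hextend h2 A hA hS V hV T 0 0 (fun i => by have := ht i; omega) H hH F hF hFJ
      (F y₁) (hF _) y₁ fun x hx hxT => ?_⟩
    have := hFJ y₁ hyH x hx fun i => ⟨hyT i, hxT i⟩
    have := hJ_deg0 A _ this ((hF _).sub (hF _))
    rw [← neg_sub, this, neg_zero]
    exact zero_mem _
  | succ s ih =>
    intro T hVT ht hH F hF hFJ
    have hHs : (2 * m + (s + 1) + 1) * p ^ (d - 1) =
      (2 * m + s + 1) * p ^ (d-1) + p ^ (d-1) := by ring
    have hHm : (2 * m + s + 1) * p ^ (d - 1) =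
      m * p ^ (d-1) + (m + s + 1) * p ^ (d-1) := by ring
    have c1 := hcard' T (fun i => by have := ht i; omega) H
    obtain ⟨y₁, hy₁⟩ : (H.filter fun y => ∀ i, y ∉ T i).Nonempty :=
      Finset.card_pos.1 (by omega)
    obtain ⟨hyH, hyT⟩ := Finset.mem_filter.1 hy₁
    have hR : ∀ x, ∃ R : MvPolynomial (Fin d) (ZMod p), R.IsHomogeneous s ∧
        (x ∈ H → (∀ i, x ∉ T i ⊔ Submodule.span (ZMod p) {y₁}) →
        F x - F y₁ - linPoly p d A y₁ * R ∈
          JM p d A ((Submodule.span (ZMod p) {x} ⊔ V : Submodule _ _) :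
            Set (Fin d → ZMod p))) := fun x => by
      by_cases hx : x ∈ H ∧ (∀ i, x ∉ T i ⊔ Submodule.span (ZMod p) {y₁})
      · have h1 := hFJ y₁ hyH x hx.1 fun i => ⟨hyT i, hx.2 i⟩
        rw [Set.pair_comm, hspan, ← neg_mem_iff, neg_sub] at h1
        obtain ⟨R, hR, h⟩ := hJ_split A _ y₁ ((hF x).sub (hF y₁)) h1
        exact ⟨R, hR, fun _ _ => h⟩
      · exact ⟨0, isHomogeneous_zero _ _ _, fun a b => absurd ⟨a, b⟩ hx⟩
    choose R hRh hRJ using hR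
    obtain ⟨G', hG', hG⟩ := ih (fun i => T i ⊔ Submodule.span (ZMod p) {y₁})
      (fun i => (hVT i).trans le_sup_left)
      (fun i => by have := ht i; have := hfin (T i) y₁; omega) (by omega) R hRh (by
        intro x hx y hy hxy
        have hyn : ∀ i, y ∉ T i ⊔ Submodule.span (ZMod p) {y₁} := fun i h =>
          (hxy i).2 (Submodule.mem_sup_left h)
        have h1 := hRJ x hx fun i => (hxy i).1
        have h3 := hRJ y hy hyn
        have h4 := hFJ x hx y hy fun i => ⟨fun h => (hxy i).1 (Submodule.mem_sup_left h),
          fun h => (hxy i).2 ((sup_le_sup_right (le_sup_left :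
            T i ≤ T i ⊔ Submodule.span (ZMod p) {y₁}) (Submodule.span (ZMod p) {x})) h)⟩
        rw [hspan] at h4 ⊢
        have h1' := hJ_mono A (show Submodule.span (ZMod p) {x} ⊔ V ≤
          (Submodule.span (ZMod p) {x} ⊔ V) ⊔ Submodule.span (ZMod p) {y} from le_sup_left) h1
        have h3' := hJ_mono A (show Submodule.span (ZMod p) {y} ⊔ V ≤
          (Submodule.span (ZMod p) {x} ⊔ V) ⊔ Submodule.span (ZMod p) {y} from
          sup_le le_sup_right (le_sup_right.trans le_sup_left)) h3
        have hf := hfin V x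
        rw [sup_comm] at hf
        have hf' := hfin (Submodule.span (ZMod p) {x} ⊔ V) y
        refine hnzd h2 A hA hS _ (by omega) y₁ ?_ ?_
        · intro hmem
          have i : Fin m := ⟨0, hm⟩
          have hle : Submodule.span (ZMod p) {x} ⊔ V ≤ T i ⊔ Submodule.span (ZMod p) {x} :=
            sup_le le_sup_right ((hVT i).trans le_sup_left)
          have k1 : y₁ ∈ (T i ⊔ Submodule.span (ZMod p) {x}) ⊔ Submodule.span (ZMod p) {y} :=
            sup_le_sup_right hle _ hmem
          by_cases k2 : y₁ ∈ T i ⊔ Submodule.span (ZMod p) {x}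
          · exact (hxy i).1 (hexch (hyT i) k2)
          · apply (hxy i).2
            rw [sup_right_comm]
            exact hexch k2 k1
        · have h5 := add_mem (sub_mem h4 h1') h3'
          have e : linPoly p d A y₁ * (R x - R y) = (F x - F y) -
            (F x - F y₁ - linPoly p d A y₁ * R x) + (F y - F y₁ - linPoly p d A y₁ * R y) := by
            ring
          rw [e]; exact h5)
    have hGh : (F y₁ + linPoly p d A y₁ * G').IsHomogeneous (s+1) := by
      refine (hF y₁).add ?_
      rw [add_comm]
      exact (hlin_homog A y₁).mul hG'
    refine ⟨_, hGh, hextend h2 A hA hS V hV T 0 (s+1) (fun i => by have := ht i; omega) H hH F hF hFJ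
      _ hGh y₁ fun x hx hxT => ?_⟩
    have k1 := hRJ x hx hxT
    have k2 := Ideal.mul_mem_left _ (linPoly p d A y₁) (hG x hx hxT)
    have e : F x - (F y₁ + linPoly p d A y₁ * G') = (F x - F y₁ - linPoly p d A y₁ * R x) +
      linPoly p d A y₁ * (R x - G') := by ring
    rw [e]; exact add_mem k1 k2

lemma hindep1 {U V : Submodule (ZMod p) (Fin d → ZMod p)} {x : Fin d → ZMod p}
    (h : VecSubIndep p d ![x] U V) : x ∉ U ⊔ V := by
  intro hx
  obtain ⟨a, ha, b, hb, rfl⟩ := Submodule.mem_sup.1 hx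
  have := (h (fun _ => -1) a ha b hb (by simp)).1 0
  simp at this

lemma hindep2 {U V : Submodule (ZMod p) (Fin d → ZMod p)} {x y : Fin d → ZMod p}
    (h : VecSubIndep p d (![] : Fin 0 → Fin d → ZMod p) U V) (hx : x ∉ U ⊔ V)
    (hy : y ∉ (U ⊔ V) ⊔ Submodule.span (ZMod p) {x}) : VecSubIndep p d ![x, y] U V := by
  intro c u hu w hw e
  simp only [Fin.sum_univ_two, Matrix.cons_val_zero, Matrix.cons_val_one] at e
  have huw : u + w ∈ U ⊔ V := Submodule.add_mem_sup hu hw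
  have c1 : c 1 = 0 := by
    by_contra h1
    apply hy
    have : y = (c 1)⁻¹ • (-(u + w) + (-c 0) • x) := by
      rw [eq_inv_smul_iff₀ h1, neg_smul, ← sub_eq_zero, ← e]; abel
    rw [this]
    exact Submodule.smul_mem _ _ (Submodule.add_mem_sup (neg_mem huw)
      (Submodule.smul_mem _ _ (Submodule.mem_span_singleton_self x)))
  rw [c1, zero_smul, add_zero] at e
  have c0 : c 0 = 0 := by
    by_contra h1
    apply hx
    have : x = (c 0)⁻¹ • (-(u + w)) := by
      rw [eq_inv_smul_iff₀ h1, ← sub_eq_zero, ← e]; abel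
    rw [this]
    exact Submodule.smul_mem _ _ (neg_mem huw)
  rw [c0, zero_smul, zero_add] at e
  refine ⟨fun l => ?_, h (fun _ => 0) u hu w hw (by simpa using e) |>.2⟩
  fin_cases l
  · exact c0
  · exact c1

end helpers

/-- If `F(x) - F(y) ∈ J^M_{span{x,y}+V}` for all suitably independent `x, y` in a dense
set `H`, then `F` is constant modulo `J^M_{span{x}+V}` on the suitably independent
elements of `H`. -/
theorem stmt10 (d k s : ℕ) (hd : 1 ≤ d) (δ : ℝ) (hδ : 0 < δ) :
    ∃ p0 : ℕ, ∀ p : ℕ, p.Prime → p0 ≤ p →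
    ∀ H : Finset (Fin d → ZMod p), δ * (p : ℝ) ^ d < (H.card : ℝ) →
    ∀ (M : (Fin d → ZMod p) → ZMod p) (A : Matrix (Fin d) (Fin d) (ZMod p))
      (uu : Fin d → ZMod p) (vv : ZMod p),
      IsQuadFormWith p d M A uu vv → A.det ≠ 0 →
    ∀ (U : Fin k → Submodule (ZMod p) (Fin d → ZMod p))
      (V : Submodule (ZMod p) (Fin d → ZMod p)),
      (∀ i j, Module.finrank (ZMod p) (U i) = Module.finrank (ZMod p) (U j)) →
      (∀ i, VecSubIndep p d (![] : Fin 0 → Fin d → ZMod p) (U i) V) →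
    ∀ F : (Fin d → ZMod p) → MvPolynomial (Fin d) (ZMod p),
      (∀ x, (F x).IsHomogeneous s) →
      (∀ x ∈ H, ∀ y ∈ H,
        (∀ i : Fin (k + 1),
          VecSubIndep p d ![x, y]
            ((Fin.cons ⊥ U : Fin (k + 1) → Submodule (ZMod p) (Fin d → ZMod p)) i) V) →
        F x - F y ∈ JM p d A
          ((Submodule.span (ZMod p) {x, y} ⊔ V : Submodule (ZMod p) (Fin d → ZMod p)) :
            Set (Fin d → ZMod p))) →
      s + Module.finrank (ZMod p)
          ((Fin.cons ⊥ U : Fin (k + 1) → Submodule (ZMod p) (Fin d → ZMod p)) (Fin.last k)) +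
        2 * Module.finrank (ZMod p) V + 8 ≤ d →
      ∃ G : MvPolynomial (Fin d) (ZMod p), G.IsHomogeneous s ∧
        ∀ x ∈ H,
          (∀ i : Fin (k + 1),
            VecSubIndep p d ![x]
              ((Fin.cons ⊥ U : Fin (k + 1) → Submodule (ZMod p) (Fin d → ZMod p)) i) V) →
          F x - G ∈ JM p d A
            ((Submodule.span (ZMod p) {x} ⊔ V : Submodule (ZMod p) (Fin d → ZMod p)) :
              Set (Fin d → ZMod p)) := by

  obtain ⟨n, hn⟩ := exists_nat_gt (((2 * (k + 1) + s + 1 : ℕ) : ℝ) / δ)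
  refine ⟨max 3 n, ?_⟩
  intro p hp hp0 H hH M A uu vv hM hA U V hUdim hUV F hF hFJ hdim
  haveI : Fact p.Prime := ⟨hp⟩
  have hp3 : 3 ≤ p := (le_max_left _ _).trans hp0
  have hpn : n ≤ p := (le_max_right _ _).trans hp0
  have h2 : (2 : ZMod p) ≠ 0 := by
    intro h
    have h' : ((2 : ℕ) : ZMod p) = 0 := by exact_mod_cast h
    have := Nat.le_of_dvd (by norm_num) ((ZMod.natCast_eq_zero_iff 2 p).1 h')
    omega
  set U' : Fin (k + 1) → Submodule (ZMod p) (Fin d → ZMod p) := Fin.cons ⊥ U with hU'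
  have hU'V : ∀ i, VecSubIndep p d (![] : Fin 0 → Fin d → ZMod p) (U' i) V := by
    intro i
    refine Fin.cases ?_ (fun j => ?_) i
    · intro c u hu w hw e
      have hu0 : u = 0 := by simpa [hU'] using hu
      subst hu0
      exact ⟨fun l => l.elim0, rfl, by simpa using e⟩
    · simpa [hU'] using hUV j
  have hU'd : ∀ i, Module.finrank (ZMod p) (U' i) ≤ Module.finrank (ZMod p) (U' (Fin.last k)) := by
    intro i
    refine Fin.cases ?_ (fun j => ?_) i
    · have : U' 0 = ⊥ := rfl
      rw [this, finrank_bot]; exact Nat.zero_le _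
    · obtain ⟨k, rfl⟩ : ∃ k', k = k' + 1 := ⟨k - 1, by have := j.2; omega⟩
      have e1 : U' j.succ = U j := rfl
      have e2 : U' (Fin.last (k+1)) = U (Fin.last k) := rfl
      rw [e1, e2]
      exact (hUdim j (Fin.last k)).le
  have hcardH : (2 * (k + 1) + s + 1) * p ^ (d - 1) < H.card := by
    have h1 : ((2 * (k + 1) + s + 1 : ℕ) : ℝ) < p * δ := by
      rw [← div_lt_iff₀ hδ]
      exact hn.trans_le (by exact_mod_cast hpn)
    have h3 : (p : ℝ) ^ d = p ^ (d - 1) * p := by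
      rw [← pow_succ, Nat.sub_add_cancel hd]
    have h4 : (0 : ℝ) < (p : ℝ) ^ (d - 1) := pow_pos (by exact_mod_cast hp.pos) _
    have h5 : (((2 * (k + 1) + s + 1) * p ^ (d - 1) : ℕ) : ℝ) < (H.card : ℝ) := by
      refine lt_trans ?_ hH
      rw [h3, Nat.cast_mul, Nat.cast_pow]
      nlinarith [mul_lt_mul_of_pos_right h1 h4]
    exact_mod_cast h5
  obtain ⟨G, hG, hGJ⟩ := hmain h2 A hA hM.1 V (by omega) (Nat.succ_pos k) H s
    (fun i => U' i ⊔ V) (fun i => le_sup_right)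
    (fun i => by
      have a1 := Submodule.finrank_add_le_finrank_add_finrank (U' i) V
      have a2 := hU'd i
      omega) hcardH F hF
    (fun x hx y hy hxy => hFJ x hx y hy fun i => hindep2 (hU'V i) (hxy i).1 (hxy i).2)
  exact ⟨G, hG, fun x hx hxi => hGJ x hx fun i => hindep1 (hxi i)⟩
end
end

section
/- Let d ≥ 1 be an integer, k, s ∈ ℕ, and δ > 0. There exists a threshold p_0 depending only on δ, d and k such that for every prime p ≥ p_0 the following holds. Let H ⊆ 𝔽_p^d with |H| > δ·p^d, let M : 𝔽_p^d → 𝔽_p be a non-degenerate quadratic form, and let U_1, …, U_k be subspaces of 𝔽_p^d all of the same dimension; set U_0 := {0}. Let F : 𝔽_p^d → HP_d(s) satisfy F(x) − F(y) ∈ J^M_{x−y} for all x, y ∈ H such that the tuple (x, y, U_i) is linearly independent for every 0 ≤ i ≤ k. If d ≥ s + dim(U_k) + 8 (with dim(U_k) interpreted as 0 when k = 0), then there exists a super polynomial G : HP_d(1) → HP_d(s) such that F(x) − G(L_x) ∈ J^M for every x ∈ H such that the tuple (x, U_i) is linearly independent for every 0 ≤ i ≤ k. -/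
noncomputable section

open MvPolynomial

/-- The linear polynomial `L_x : n ↦ (nA)·x`. -/
def lx (p d : ℕ) (A : Matrix (Fin d) (Fin d) (ZMod p)) (x : Fin d → ZMod p) :
    MvPolynomial (Fin d) (ZMod p) :=
  ∑ i : Fin d, MvPolynomial.C (∑ j : Fin d, A i j * x j) * MvPolynomial.X i


def lf {K : Type*} [Field K] {d : ℕ} (c : Fin d → K) : MvPolynomial (Fin d) K :=
  ∑ j : Fin d, C (c j) * X j

section lfsec
open scoped Matrix
variable {K : Type*} [Field K] {d : ℕ}

lemma lf_add (a b : Fin d → K) : lf (a + b) = lf a + lf b := by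
  simp [lf, add_mul, Finset.sum_add_distrib]

lemma lf_sub (a b : Fin d → K) : lf (a - b) = lf a - lf b := by
  simp [lf, sub_mul, Finset.sum_sub_distrib]

lemma lf_smul (t : K) (a : Fin d → K) : lf (t • a) = C t * lf a := by
  simp [lf, Finset.mul_sum, mul_assoc]

lemma lf_homog (a : Fin d → K) : (lf a).IsHomogeneous 1 := by
  apply IsHomogeneous.sum
  intro i _
  simpa using (isHomogeneous_C (Fin d) (a i)).mul (isHomogeneous_X K i)

lemma lf_eval (a n : Fin d → K) : eval n (lf a) = a ⬝ᵥ n := by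
  simp [lf, dotProduct]

lemma lf_aeval (a : Fin d → K) (φ : MvPolynomial (Fin d) K →ₐ[K] MvPolynomial (Fin d) K) :
    φ (lf a) = ∑ j, C (a j) * φ (X j) := by
  simp only [lf, map_sum, map_mul]
  refine Finset.sum_congr rfl fun i _ => ?_
  congr 1
  exact φ.commutes (a i)

/-- If an algebra endomorphism is the identity modulo `I`. -/
lemma sub_mem_of_X (I : Ideal (MvPolynomial (Fin d) K))
    (φ : MvPolynomial (Fin d) K →ₐ[K] MvPolynomial (Fin d) K)
    (h : ∀ i, X i - φ (X i) ∈ I) (f : MvPolynomial (Fin d) K) : f - φ f ∈ I := by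
  have : (Ideal.Quotient.mkₐ K I) = (Ideal.Quotient.mkₐ K I).comp φ := by
    apply MvPolynomial.algHom_ext
    intro i
    simpa [Ideal.Quotient.mkₐ_eq_mk] using (Ideal.Quotient.eq.2 (h i))
  have h2 := congrArg (fun g => g f) this
  exact Ideal.Quotient.eq.1 h2

lemma lf_ne_zero {c e : Fin d → K} (h : c ⬝ᵥ e = 1) : lf c ≠ 0 := by
  intro h0
  have := lf_eval c e
  rw [h0, h] at this
  simp at this

lemma dvd_of_mul {c c' e e' : Fin d → K} (h1 : c ⬝ᵥ e = 1) (h3 : c' ⬝ᵥ e = 0)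
    (h4 : c' ⬝ᵥ e' = 1) (g b : MvPolynomial (Fin d) K)
    (h : lf c' * g = b * lf c) : lf c ∣ g := by
  let φ : MvPolynomial (Fin d) K →ₐ[K] MvPolynomial (Fin d) K :=
    aeval (fun i => X i - C (e i) * lf c)
  have hX : ∀ i, φ (X i) = X i - C (e i) * lf c := fun i => by simp [φ]
  have hl : ∀ a, φ (lf a) = lf a - C (a ⬝ᵥ e) * lf c := by
    intro a
    rw [lf_aeval]
    simp only [hX, mul_sub, Finset.sum_sub_distrib, dotProduct, map_sum, Finset.sum_mul, map_mul,
      mul_assoc]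
    rfl
  have e1 := congrArg φ h
  rw [map_mul, map_mul, hl, hl, h1, h3] at e1
  simp only [map_zero, zero_mul, sub_zero, map_one, one_mul, sub_self, mul_zero] at e1
  have : φ g = 0 := (mul_eq_zero.1 e1).resolve_left (lf_ne_zero h4)
  have h5 := sub_mem_of_X (Ideal.span {lf c}) φ (fun i => by
    rw [hX, sub_sub_cancel]
    exact Ideal.mul_mem_left _ _ (Ideal.mem_span_singleton_self _)) g
  rw [this, sub_zero] at h5
  exact Ideal.mem_span_singleton.1 h5

lemma prime2 {c c' e e' : Fin d → K} (h1 : c ⬝ᵥ e = 1) (h2 : c ⬝ᵥ e' = 0) (h3 : c' ⬝ᵥ e = 0)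
    (h4 : c' ⬝ᵥ e' = 1) (a q : MvPolynomial (Fin d) K)
    (n : Fin d → K) (hn : c ⬝ᵥ n = 0) (hn' : c' ⬝ᵥ n = 0) (hq : eval n q ≠ 0)
    (h : a * q ∈ Ideal.span {lf c, lf c'}) : a ∈ Ideal.span {lf c, lf c'} := by
  let φ : MvPolynomial (Fin d) K →ₐ[K] MvPolynomial (Fin d) K :=
    aeval (fun i => X i - C (e i) * lf c - C (e' i) * lf c')
  have hX : ∀ i, φ (X i) = X i - C (e i) * lf c - C (e' i) * lf c' := fun i => by simp [φ]
  have hl : ∀ a, φ (lf a) = lf a - C (a ⬝ᵥ e) * lf c - C (a ⬝ᵥ e') * lf c' := by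
    intro a
    rw [lf_aeval]
    simp only [hX, mul_sub, Finset.sum_sub_distrib, dotProduct, map_sum, Finset.sum_mul, map_mul,
      mul_assoc]
    rfl
  have hc : φ (lf c) = 0 := by rw [hl, h1, h2]; simp
  have hc' : φ (lf c') = 0 := by rw [hl, h3, h4]; simp
  have hm : lf c ∈ Ideal.span {lf c, lf c'} := Ideal.subset_span (by simp)
  have hm' : lf c' ∈ Ideal.span {lf c, lf c'} := Ideal.subset_span (by simp)
  have h5 := sub_mem_of_X (Ideal.span {lf c, lf c'}) φ (fun i => by
    rw [hX, sub_sub, sub_sub_cancel]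
    exact Ideal.add_mem _ (Ideal.mul_mem_left _ _ hm) (Ideal.mul_mem_left _ _ hm'))
  have h0 : φ a * φ q = 0 := by
    obtain ⟨u, v, huv⟩ := Ideal.mem_span_pair.1 h
    rw [← map_mul, ← huv]
    simp [hc, hc']
  have hqn : φ q ≠ 0 := by
    intro h6
    have h7 := h5 q
    rw [h6, sub_zero] at h7
    obtain ⟨u, v, huv⟩ := Ideal.mem_span_pair.1 h7
    apply hq
    rw [← huv]
    simp [lf_eval, hn, hn']
  have := h5 a
  rwa [(mul_eq_zero.1 h0).resolve_right hqn, sub_zero] at this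

lemma regular {c c' e e' : Fin d → K} (h1 : c ⬝ᵥ e = 1) (h2 : c ⬝ᵥ e' = 0) (h3 : c' ⬝ᵥ e = 0)
    (h4 : c' ⬝ᵥ e' = 1) (f q : MvPolynomial (Fin d) K)
    (n : Fin d → K) (hn : c ⬝ᵥ n = 0) (hn' : c' ⬝ᵥ n = 0) (hq : eval n q ≠ 0)
    (h : lf c' * f ∈ Ideal.span {q, lf c}) : f ∈ Ideal.span {q, lf c} := by
  obtain ⟨a, b, hab⟩ := Ideal.mem_span_pair.1 h
  have ha : a ∈ Ideal.span {lf c, lf c'} := by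
    apply prime2 h1 h2 h3 h4 a q n hn hn' hq
    rw [Ideal.mem_span_pair]
    exact ⟨-b, f, by linear_combination -hab⟩
  obtain ⟨u, v, huv⟩ := Ideal.mem_span_pair.1 ha
  obtain ⟨w, hw⟩ := dvd_of_mul h1 h3 h4 (f - v * q) (b + u * q) (by
    rw [← huv] at hab
    linear_combination -hab)
  rw [Ideal.mem_span_pair]
  exact ⟨v, w, by linear_combination -hw⟩

lemma exists_dual {c c' : Fin d → K} (h : LinearIndependent K ![c, c']) :
    ∃ e e' : Fin d → K, c ⬝ᵥ e = 1 ∧ c ⬝ᵥ e' = 0 ∧ c' ⬝ᵥ e = 0 ∧ c' ⬝ᵥ e' = 1 := by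
  have key : ∀ t : Fin 2 → K, ∃ e : Fin d → K, c ⬝ᵥ e = t 0 ∧ c' ⬝ᵥ e = t 1 := by
    intro t
    have hr : (Matrix.of ![c, c']).mulVec.Surjective := by
      have h1 : (Matrix.of ![c, c']).rank = Fintype.card (Fin 2) :=
        LinearIndependent.rank_matrix (M := Matrix.of ![c, c']) h
      have h2 : LinearMap.range (Matrix.of ![c, c']).mulVecLin = ⊤ := by
        apply Submodule.eq_top_of_finrank_eq
        rw [Matrix.rank] at h1
        rw [h1]
        simp
      exact LinearMap.range_eq_top.1 h2
    obtain ⟨e, he⟩ := hr t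
    exact ⟨e, by rw [← he]; rfl, by rw [← he]; rfl⟩
  obtain ⟨e, a, b⟩ := key ![1, 0]
  obtain ⟨e', a', b'⟩ := key ![0, 1]
  exact ⟨e, e', a, a', b, b'⟩

lemma exists_nonvanish (hd : 5 ≤ d) (h2 : (2 : K) ≠ 0) (A : Matrix (Fin d) (Fin d) K)
    (hA : A.IsSymm) (hdet : A.det ≠ 0) {h h' e e' : Fin d → K}
    (h1 : (Matrix.vecMul h A) ⬝ᵥ e = 1) (h2' : (Matrix.vecMul h A) ⬝ᵥ e' = 0)
    (h3 : (Matrix.vecMul h' A) ⬝ᵥ e = 0)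
    (h4 : (Matrix.vecMul h' A) ⬝ᵥ e' = 1) :
    ∃ n, (Matrix.vecMul h A) ⬝ᵥ n = 0 ∧ (Matrix.vecMul h' A) ⬝ᵥ n = 0 ∧
      (Matrix.vecMul n A) ⬝ᵥ n ≠ 0 := by
  by_contra! hcon
  have hinj : Function.Injective A.vecMul := by
    apply Matrix.vecMul_injective_of_isUnit
    rw [Matrix.isUnit_iff_isUnit_det]
    exact hdet.isUnit
  have hsymm : ∀ a b : Fin d → K, (Matrix.vecMul a A) ⬝ᵥ b = (Matrix.vecMul b A) ⬝ᵥ a := by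
    intro a b
    rw [← Matrix.dotProduct_mulVec, ← Matrix.vecMul_transpose, hA.eq, dotProduct_comm]
  let f : (Fin d → K) →ₗ[K] (Fin 2 → K) := Matrix.mulVecLin (Matrix.of ![h ᵥ* A, h' ᵥ* A])
  have hf : ∀ n, f n = 0 → (Matrix.vecMul h A) ⬝ᵥ n = 0 ∧ (Matrix.vecMul h' A) ⬝ᵥ n = 0 := by
    intro n hn
    exact ⟨congrFun hn 0, congrFun hn 1⟩
  have hle : LinearMap.ker f ≤ Submodule.span K (Set.range ![h, h']) := by
    intro n hn
    obtain ⟨hn1, hn2⟩ := hf n hn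
    have hpol : ∀ m, (Matrix.vecMul h A) ⬝ᵥ m = 0 → (Matrix.vecMul h' A) ⬝ᵥ m = 0 →
        (Matrix.vecMul n A) ⬝ᵥ m = 0 := by
      intro m hm1 hm2
      have a1 := hcon n hn1 hn2
      have a2 := hcon m hm1 hm2
      have a3 := hcon (n + m) (by rw [dotProduct_add, hn1, hm1, add_zero])
        (by rw [dotProduct_add, hn2, hm2, add_zero])
      rw [Matrix.add_vecMul, dotProduct_add, add_dotProduct, add_dotProduct, a1, a2,
        hsymm m n] at a3
      have : (2 : K) * (Matrix.vecMul n A ⬝ᵥ m) = 0 := by linear_combination a3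
      exact (mul_eq_zero.1 this).resolve_left h2
    have hn3 : n = (n ᵥ* A ⬝ᵥ e) • h + (n ᵥ* A ⬝ᵥ e') • h' := by
      apply hinj
      apply dotProduct_eq
      intro m
      have := hpol (m - (h ᵥ* A ⬝ᵥ m) • e - (h' ᵥ* A ⬝ᵥ m) • e')
        (by simp [dotProduct_sub, dotProduct_smul, h1, h2'])
        (by simp [dotProduct_sub, dotProduct_smul, h3, h4])
      simp only [dotProduct_sub, dotProduct_smul, smul_eq_mul] at this
      simp only [Matrix.add_vecMul, Matrix.smul_vecMul, add_dotProduct, smul_dotProduct,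
        smul_eq_mul]
      linear_combination this
    rw [hn3]
    exact Submodule.add_mem _
      (Submodule.smul_mem _ _ (Submodule.subset_span ⟨0, rfl⟩))
      (Submodule.smul_mem _ _ (Submodule.subset_span ⟨1, rfl⟩))
  have c1 := Submodule.finrank_mono hle
  have c2 := finrank_range_le_card (R := K) ![h, h']
  have c3 := f.finrank_range_add_finrank_ker
  have c4 := (LinearMap.range f).finrank_le
  simp [Set.finrank] at c1 c2 c3 c4
  omega

end lfsec

section homog
variable {K : Type*} [Field K] {d : ℕ}

lemma hc_mul_aux (f g : MvPolynomial (Fin d) K) (m : ℕ) (hg : g.IsHomogeneous m) (n : ℕ) :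
    (∀ i, i + m = n → homogeneousComponent n (f * g) = homogeneousComponent i f * g) ∧
    (n < m → homogeneousComponent n (f * g) = 0) := by
  let _ : GradedAlgebra (homogeneousSubmodule (Fin d) K) := MvPolynomial.gradedAlgebra
  have key : ∀ (f : MvPolynomial (Fin d) K) (n : ℕ),
      ((DirectSum.decompose (homogeneousSubmodule (Fin d) K) f n :
        homogeneousSubmodule (Fin d) K n) : MvPolynomial (Fin d) K) = homogeneousComponent n f :=
    fun f n => decomposition.decompose'_apply f n
  constructor
  · rintro i rfl
    rw [← key, ← key]
    exact DirectSum.coe_decompose_mul_add_of_right_mem (homogeneousSubmodule (Fin d) K) hg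
  · intro h
    rw [← key]
    exact DirectSum.coe_decompose_mul_of_right_mem_of_not_le (homogeneousSubmodule (Fin d) K) hg
      (not_le.2 h)

lemma hc_mul (i j : ℕ) (a b : MvPolynomial (Fin d) K) (hb : b.IsHomogeneous j) :
    homogeneousComponent (i + j) (a * b) = homogeneousComponent i a * b :=
  (hc_mul_aux a b j hb (i + j)).1 i rfl

lemma hc_dvd (n m : ℕ) (f q : MvPolynomial (Fin d) K) (hq : q.IsHomogeneous m) (h : q ∣ f) :
    q ∣ homogeneousComponent n f := by
  obtain ⟨a, rfl⟩ := h
  rw [mul_comm]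
  by_cases hmn : m ≤ n
  · obtain ⟨i, rfl⟩ := Nat.exists_eq_add_of_le' hmn
    rw [hc_mul _ _ _ _ hq]
    exact dvd_mul_left _ _
  · rw [(hc_mul_aux a q m hq n).2 (not_le.1 hmn)]
    exact dvd_zero _

lemma extract (s : ℕ) (E q l : MvPolynomial (Fin d) K) (hE : E.IsHomogeneous (s + 1))
    (hq : q.IsHomogeneous 2) (hl : l.IsHomogeneous 1) (h : E ∈ Ideal.span {q, l}) :
    ∃ b : MvPolynomial (Fin d) K, b.IsHomogeneous s ∧ q ∣ E - l * b := by
  obtain ⟨a, b, hab⟩ := Ideal.mem_span_pair.1 h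
  refine ⟨homogeneousComponent s b, homogeneousComponent_isHomogeneous _ _, ?_⟩
  have h1 : q ∣ homogeneousComponent (s + 1) (E - b * l) :=
    hc_dvd _ 2 _ _ hq ⟨a, by linear_combination -hab⟩
  rw [map_sub, hc_mul _ _ _ _ hl, homogeneousComponent_eq_self hE] at h1
  rwa [mul_comm l]

lemma zero_of_homog0 (E q l : MvPolynomial (Fin d) K) (hE : E.IsHomogeneous 0)
    (hq : q.IsHomogeneous 2) (hl : l.IsHomogeneous 1) (h : E ∈ Ideal.span {q, l}) : E = 0 := by
  obtain ⟨a, b, hab⟩ := Ideal.mem_span_pair.1 h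
  have hq0 : coeff 0 q = 0 := hq.coeff_eq_zero (by simp)
  have hl0 : coeff 0 l = 0 := hl.coeff_eq_zero (by simp)
  have h0 : constantCoeff E = 0 := by
    rw [← constantCoeff_eq] at hq0 hl0
    rw [← hab, map_add, map_mul, map_mul, hq0, hl0, mul_zero, mul_zero, add_zero]
  have : E = C (coeff 0 E) := by
    rw [← homogeneousComponent_zero, homogeneousComponent_eq_self hE]
  rw [this, ← constantCoeff_eq, h0, map_zero]

end homog

lemma avoid {p d : ℕ} [Fact p.Prime] (Vs : List (Submodule (ZMod p) (Fin d → ZMod p)))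
    (hV : ∀ V ∈ Vs, Module.finrank (ZMod p) V + 1 ≤ d) :
    ∀ H : Finset (Fin d → ZMod p), Vs.length * p ^ (d - 1) < H.card →
    ∃ y ∈ H, ∀ V ∈ Vs, y ∉ V := by
  classical
  induction Vs with
  | nil =>
    intro H hH
    simp at hH
    obtain ⟨y, hy⟩ := hH
    exact ⟨y, hy, by simp⟩
  | cons V Vs ih =>
    intro H hH
    have hc : (H.filter (fun y => y ∈ V)).card ≤ p ^ (d - 1) := by
      have h1 : (H.filter (fun y => y ∈ V)).card ≤ Nat.card V := by
        rw [Nat.card_eq_fintype_card, Fintype.card_subtype]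
        apply Finset.card_le_card
        intro y hy
        simp at hy ⊢
        exact hy.2
      have h2 : Nat.card V = p ^ Module.finrank (ZMod p) V := by
        rw [Nat.card_eq_fintype_card, Module.card_eq_pow_finrank (K := ZMod p), ZMod.card]
      rw [h2] at h1
      refine h1.trans (Nat.pow_le_pow_right (Fact.out : p.Prime).pos ?_)
      have := hV V (by simp)
      omega
    have hs := Finset.card_filter_add_card_filter_not (s := H) (fun y => y ∈ V)
    rw [List.length_cons, add_mul, one_mul] at hH
    obtain ⟨y, hy, hy2⟩ := ih (fun V hV' => hV V (by simp [hV'])) (H.filter (fun y => y ∉ V))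
      (by omega)
    rw [Finset.mem_filter] at hy
    refine ⟨y, hy.1, ?_⟩
    intro V' hV'
    rcases List.mem_cons.1 hV' with rfl | h
    · exact hy.2
    · exact hy2 _ h

lemma finrank_sup_span_le {p d : ℕ} [Fact p.Prime] (V : Submodule (ZMod p) (Fin d → ZMod p))
    (x : Fin d → ZMod p) :
    Module.finrank (ZMod p) ↥(V ⊔ Submodule.span (ZMod p) {x}) ≤
      Module.finrank (ZMod p) V + 1 := by
  refine (Submodule.finrank_add_le_finrank_add_finrank _ _).trans ?_
  have := finrank_span_le_card (R := ZMod p) ({x} : Set (Fin d → ZMod p))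
  simp at this
  omega

lemma mem_sup_span {p d : ℕ} [Fact p.Prime] (V : Submodule (ZMod p) (Fin d → ZMod p))
    (x y : Fin d → ZMod p) :
    y ∈ V ⊔ Submodule.span (ZMod p) {x} ↔ ∃ a : ZMod p, y - a • x ∈ V := by
  rw [Submodule.mem_sup]
  constructor
  · rintro ⟨v, hv, z, hz, rfl⟩
    obtain ⟨a, rfl⟩ := Submodule.mem_span_singleton.1 hz
    exact ⟨a, by simpa using hv⟩
  · rintro ⟨a, ha⟩
    exact ⟨_, ha, a • x, Submodule.mem_span_singleton.2 ⟨a, rfl⟩, by simp⟩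

lemma pair_of_notMem {p d : ℕ} [Fact p.Prime] (V : Submodule (ZMod p) (Fin d → ZMod p))
    (x y : Fin d → ZMod p) (hx : x ∉ V) (hy : y ∉ V ⊔ Submodule.span (ZMod p) {x})
    (a b : ZMod p) (h : a • x + b • y ∈ V) : a = 0 ∧ b = 0 := by
  have hb : b = 0 := by
    by_contra hb
    apply hy
    rw [mem_sup_span]
    refine ⟨-(b⁻¹ * a), ?_⟩
    have := V.smul_mem b⁻¹ h
    rw [smul_add, smul_smul, smul_smul, inv_mul_cancel₀ hb, one_smul] at this
    convert this using 1
    rw [neg_smul, sub_neg_eq_add, add_comm]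
  refine ⟨?_, hb⟩
  by_contra ha
  rw [hb, zero_smul, add_zero] at h
  exact hx ((V.smul_mem_iff ha).1 h)

section mainsec
open scoped Matrix
variable {p d : ℕ} [Fact p.Prime] (A : Matrix (Fin d) (Fin d) (ZMod p))

def ell (x : Fin d → ZMod p) : MvPolynomial (Fin d) (ZMod p) := lf (x ᵥ* A)

lemma ell_sub (x y : Fin d → ZMod p) : ell A (x - y) = ell A x - ell A y := by
  rw [ell, Matrix.sub_vecMul, lf_sub]; rfl

lemma ell_smul (t : ZMod p) (x : Fin d → ZMod p) : ell A (t • x) = C t * ell A x := by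
  rw [ell, Matrix.smul_vecMul, lf_smul]; rfl

lemma ell_homog (x : Fin d → ZMod p) : (ell A x).IsHomogeneous 1 := lf_homog _

lemma linPoly_eq (x : Fin d → ZMod p) : linPoly p d A x = ell A x := rfl

lemma lx_eq (hA : A.IsSymm) (x : Fin d → ZMod p) : lx p d A x = ell A x := by
  have : ell A x = lf (A *ᵥ x) := by
    rw [ell, ← Matrix.vecMul_transpose, hA.eq]
  rw [this]
  rfl

lemma quad_homog : (quadPoly p d A).IsHomogeneous 2 := by
  apply IsHomogeneous.sum
  intro i _
  apply IsHomogeneous.sum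
  intro j _
  simpa using (isHomogeneous_C (Fin d) (A i j)).mul
    ((isHomogeneous_X (ZMod p) i).mul (isHomogeneous_X (ZMod p) j))

lemma quad_eval (n : Fin d → ZMod p) : eval n (quadPoly p d A) = n ᵥ* A ⬝ᵥ n := by
  simp only [quadPoly, map_sum, map_mul, eval_C, eval_X, dotProduct, Matrix.vecMul,
    Finset.sum_mul]
  rw [Finset.sum_comm]
  refine Finset.sum_congr rfl fun i _ => Finset.sum_congr rfl fun j _ => ?_
  ring

lemma JM_span (x : Fin d → ZMod p) :
    JM p d A (Submodule.span (ZMod p) {x} : Set (Fin d → ZMod p)) =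
      Ideal.span {quadPoly p d A, ell A x} := by
  apply le_antisymm
  · rw [JM, Ideal.span_le]
    rintro f (hf | ⟨y, hy, rfl⟩)
    · rw [Set.mem_singleton_iff.1 hf]
      exact Ideal.subset_span (by simp)
    · obtain ⟨t, rfl⟩ := Submodule.mem_span_singleton.1 hy
      rw [linPoly_eq, ell_smul]
      exact Ideal.mul_mem_left _ _ (Ideal.subset_span (by simp))
  · rw [Ideal.span_le]
    rintro f (hf | hf)
    · rw [hf]
      exact Ideal.subset_span (by simp)
    · rw [Set.mem_singleton_iff.1 hf]
      exact Ideal.subset_span (Or.inr ⟨x, Submodule.mem_span_singleton_self x, rfl⟩)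

lemma mem_JM_bot {f : MvPolynomial (Fin d) (ZMod p)} (h : quadPoly p d A ∣ f) :
    f ∈ JM p d A ((⊥ : Submodule (ZMod p) (Fin d → ZMod p)) : Set (Fin d → ZMod p)) := by
  obtain ⟨a, rfl⟩ := h
  exact Ideal.mul_mem_right _ _ (Ideal.subset_span (by simp))

variable (hd : 5 ≤ d) (h2 : (2 : ZMod p) ≠ 0) (hA : A.IsSymm) (hdet : A.det ≠ 0)
include hd h2 hA hdet

lemma reg {h h' : Fin d → ZMod p} (hi : ∀ a b : ZMod p, a • h + b • h' = 0 → a = 0 ∧ b = 0)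
    (f : MvPolynomial (Fin d) (ZMod p))
    (hf : ell A h' * f ∈ Ideal.span {quadPoly p d A, ell A h}) :
    f ∈ Ideal.span {quadPoly p d A, ell A h} := by
  have hinj : Function.Injective A.vecMul := by
    apply Matrix.vecMul_injective_of_isUnit
    rw [Matrix.isUnit_iff_isUnit_det]
    exact hdet.isUnit
  obtain ⟨e, e', a1, a2, a3, a4⟩ := exists_dual (c := h ᵥ* A) (c' := h' ᵥ* A) (by
    rw [LinearIndependent.pair_iff]
    intro a b hab
    apply hi
    apply hinj
    simpa [Matrix.add_vecMul, Matrix.smul_vecMul] using hab)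
  obtain ⟨n, b1, b2, b3⟩ := exists_nonvanish hd h2 A hA hdet a1 a2 a3 a4
  exact regular a1 a2 a3 a4 f _ n b1 b2 (by rwa [quad_eval]) hf

lemma vanish (H : Finset (Fin d → ZMod p)) (x : Fin d → ZMod p) (s : ℕ) :
    ∀ (Vs : List (Submodule (ZMod p) (Fin d → ZMod p))) (E : MvPolynomial (Fin d) (ZMod p)),
    (∀ V ∈ Vs, Module.finrank (ZMod p) V + 1 ≤ d) → (∃ V ∈ Vs, x ∈ V) →
    (Vs.length + s) * p ^ (d - 1) < H.card → E.IsHomogeneous s →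
    (∀ y ∈ H, (∀ V ∈ Vs, y ∉ V) → E ∈ Ideal.span {quadPoly p d A, ell A (x - y)}) →
    quadPoly p d A ∣ E := by
  induction s with
  | zero =>
    intro Vs E hV hx hc hE h
    obtain ⟨y, hy, hy2⟩ := avoid Vs hV H (by simpa using hc)
    rw [zero_of_homog0 E _ _ hE (quad_homog A) (ell_homog A _) (h y hy hy2)]
    exact dvd_zero _
  | succ s ih =>
    intro Vs E hV hx hc hE h
    obtain ⟨y, hy, hy2⟩ := avoid Vs hV H
      (lt_of_le_of_lt (Nat.mul_le_mul_right _ (by omega)) hc)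
    obtain ⟨b, hb, c, hc2⟩ := extract s E _ _ hE (quad_homog A) (ell_homog A _) (h y hy hy2)
    have key : quadPoly p d A ∣ b := by
      apply ih (Submodule.span (ZMod p) {x} ⊔ Submodule.span (ZMod p) {y} :: Vs) b
      · intro V hV'
        rcases List.mem_cons.1 hV' with rfl | h'
        · have e1 := finrank_sup_span_le (Submodule.span (ZMod p) {x}) y
          have e2 := finrank_span_le_card (R := ZMod p) ({x} : Set (Fin d → ZMod p))
          simp at e2
          omega
        · exact hV V h'
      · obtain ⟨V, hV1, hV2⟩ := hx
        exact ⟨V, by simp [hV1], hV2⟩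
      · rw [List.length_cons]
        convert hc using 2
        omega
      · exact hb
      · intro z hz hz2
        have hz3 := hz2 _ (List.mem_cons_self)
        have hz4 : ∀ V ∈ Vs, z ∉ V := fun V hV => hz2 V (List.mem_cons_of_mem _ hV)
        have hxy : x - y ≠ 0 := by
          obtain ⟨V, hV1, hV2⟩ := hx
          intro h0
          rw [sub_eq_zero] at h0
          exact hy2 V hV1 (h0 ▸ hV2)
        apply reg A hd h2 hA hdet (h := x - z) (h' := x - y)
        · intro a b hab
          have ha : a = 0 := by
            by_contra ha
            apply hz3
            have e1 : z = (a⁻¹ * (a + b)) • x + (-(a⁻¹ * b)) • y := by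
              have e2 : a • z = (a + b) • x - b • y := by
                have := hab
                rw [smul_sub, smul_sub] at this
                rw [add_smul]
                linear_combination (exp := 1) -this
              rw [← one_smul (ZMod p) z, ← inv_mul_cancel₀ ha, mul_smul, e2, smul_sub, smul_smul,
                smul_smul, neg_smul, sub_eq_add_neg]
            rw [e1]
            exact Submodule.add_mem_sup
              (Submodule.smul_mem _ _ (Submodule.mem_span_singleton_self x))
              (Submodule.smul_mem _ _ (Submodule.mem_span_singleton_self y))
          refine ⟨ha, ?_⟩
          rw [ha, zero_smul, zero_add] at hab
          exact (smul_eq_zero.1 hab).resolve_right hxy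
        · have := h z hz hz4
          have e1 : ell A (x - y) * b = E - quadPoly p d A * c := by linear_combination -hc2
          rw [e1]
          exact Ideal.sub_mem _ this (Ideal.mul_mem_right _ _ (Ideal.subset_span (by simp)))
    obtain ⟨b', rfl⟩ := key
    exact ⟨c + ell A (x - y) * b', by linear_combination hc2⟩

lemma extend (H : Finset (Fin d → ZMod p)) (s : ℕ)
    (Ws : List (Submodule (ZMod p) (Fin d → ZMod p)))
    (F : (Fin d → ZMod p) → MvPolynomial (Fin d) (ZMod p)) (hne : Ws ≠ [])
    (hW : ∀ V ∈ Ws, Module.finrank (ZMod p) V + s + 2 ≤ d)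
    (hc : (2 * Ws.length + s) * p ^ (d - 1) < H.card)
    (hF : ∀ x, (F x).IsHomogeneous s)
    (h : ∀ x ∈ H, ∀ y ∈ H,
      (∀ V ∈ Ws, ∀ a b : ZMod p, a • x + b • y ∈ V → a = 0 ∧ b = 0) →
      F x - F y ∈ Ideal.span {quadPoly p d A, ell A (x - y)})
    (x0 : Fin d → ZMod p)
    (G : Polynomial (MvPolynomial (Fin d) (ZMod p)))
    (hG1 : ∀ i, (G.coeff i).IsHomogeneous (s - i)) (hG2 : ∀ i, s < i → G.coeff i = 0)
    (hG3 : ∀ x ∈ H, (∀ V ∈ Ws, x ∉ V ⊔ Submodule.span (ZMod p) {x0}) →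
      quadPoly p d A ∣ F x - G.eval (ell A x)) :
    ∀ x ∈ H, (∀ V ∈ Ws, x ∉ V) → quadPoly p d A ∣ F x - G.eval (ell A x) := by
  intro x hx hxW
  apply vanish A hd h2 hA hdet H x s
    (Ws.map (fun V => V ⊔ Submodule.span (ZMod p) {x}) ++
      Ws.map (fun V => V ⊔ Submodule.span (ZMod p) {x0}))
  · intro V hV
    rw [List.mem_append, List.mem_map, List.mem_map] at hV
    rcases hV with ⟨V', hV', rfl⟩ | ⟨V', hV', rfl⟩
    · have := finrank_sup_span_le V' x
      have := hW V' hV'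
      omega
    · have := finrank_sup_span_le V' x0
      have := hW V' hV'
      omega
  · obtain ⟨V, hV⟩ := List.exists_mem_of_ne_nil _ hne
    refine ⟨V ⊔ Submodule.span (ZMod p) {x}, ?_, ?_⟩
    · rw [List.mem_append, List.mem_map]
      exact Or.inl ⟨V, hV, rfl⟩
    · exact (le_sup_right : _ ≤ V ⊔ Submodule.span (ZMod p) {x})
        (Submodule.mem_span_singleton_self x)
  · rw [List.length_append, List.length_map, List.length_map, ← two_mul]
    exact hc
  · apply (hF x).sub
    rw [Polynomial.eval_eq_sum_range' (n := s + 1)]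
    · apply IsHomogeneous.sum
      intro i hi
      have := (hG1 i).mul ((ell_homog A x).pow i)
      rw [Finset.mem_range] at hi
      rwa [one_mul, Nat.sub_add_cancel (by omega)] at this
    · rw [Nat.lt_succ_iff]
      exact Polynomial.natDegree_le_iff_coeff_eq_zero.2 hG2
  · intro y hy hyV
    have hy1 : ∀ V ∈ Ws, y ∉ V ⊔ Submodule.span (ZMod p) {x} := fun V hV =>
      hyV _ (List.mem_append_left _ (List.mem_map.2 ⟨V, hV, rfl⟩))
    have hy2 : ∀ V ∈ Ws, y ∉ V ⊔ Submodule.span (ZMod p) {x0} := fun V hV =>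
      hyV _ (List.mem_append_right _ (List.mem_map.2 ⟨V, hV, rfl⟩))
    have e1 := h x hx y hy (fun V hV => pair_of_notMem V x y (hxW V hV) (hy1 V hV))
    obtain ⟨c, hc⟩ := hG3 y hy hy2
    obtain ⟨c', hc'⟩ := Polynomial.sub_dvd_eval_sub (ell A x) (ell A y) G
    have e2 : F x - G.eval (ell A x) =
        (F x - F y) + (c * quadPoly p d A + (-c') * ell A (x - y)) := by
      rw [ell_sub]
      linear_combination hc - hc'
    rw [e2]
    exact Ideal.add_mem _ e1 (Ideal.mem_span_pair.2 ⟨c, -c', rfl⟩)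

lemma mainlem (H : Finset (Fin d → ZMod p)) (s : ℕ) :
    ∀ (Ws : List (Submodule (ZMod p) (Fin d → ZMod p)))
      (F : (Fin d → ZMod p) → MvPolynomial (Fin d) (ZMod p)),
    Ws ≠ [] → (∀ V ∈ Ws, Module.finrank (ZMod p) V + s + 2 ≤ d) →
    (2 * Ws.length + s) * p ^ (d - 1) < H.card →
    (∀ x, (F x).IsHomogeneous s) →
    (∀ x ∈ H, ∀ y ∈ H,
      (∀ V ∈ Ws, ∀ a b : ZMod p, a • x + b • y ∈ V → a = 0 ∧ b = 0) →
      F x - F y ∈ Ideal.span {quadPoly p d A, ell A (x - y)}) →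
    ∃ G : Polynomial (MvPolynomial (Fin d) (ZMod p)),
      (∀ i, (G.coeff i).IsHomogeneous (s - i)) ∧ (∀ i, s < i → G.coeff i = 0) ∧
      ∀ x ∈ H, (∀ V ∈ Ws, x ∉ V) → quadPoly p d A ∣ F x - G.eval (ell A x) := by
  induction s with
  | zero =>
    intro Ws F hne hW hc hF h
    obtain ⟨x0, hx0, hx0W⟩ := avoid Ws (fun V hV => by have := hW V hV; omega) H
      (lt_of_le_of_lt (Nat.mul_le_mul_right _ (by omega)) hc)
    have hG1 : ∀ i, ((Polynomial.C (F x0)).coeff i).IsHomogeneous (0 - i) := by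
      intro i
      rw [Polynomial.coeff_C, Nat.zero_sub]
      split_ifs
      · exact hF x0
      · exact isHomogeneous_zero _ _ _
    have hG2 : ∀ i, 0 < i → (Polynomial.C (F x0)).coeff i = 0 := by
      intro i hi
      rw [Polynomial.coeff_C, if_neg (by omega)]
    refine ⟨Polynomial.C (F x0), hG1, hG2, ?_⟩
    apply extend A hd h2 hA hdet H 0 Ws F hne hW hc hF h x0 _ hG1 hG2
    intro x hx hxW
    have := h x0 hx0 x hx (fun V hV => pair_of_notMem V x0 x (hx0W V hV) (hxW V hV))
    have h0 := zero_of_homog0 _ _ _ ((hF x0).sub (hF x)) (quad_homog A) (ell_homog A _) this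
    rw [Polynomial.eval_C, ← neg_sub, h0, neg_zero]
    exact dvd_zero _
  | succ s ih =>
    intro Ws F hne hW hc hF h
    obtain ⟨x0, hx0, hx0W⟩ := avoid Ws (fun V hV => by have := hW V hV; omega) H
      (lt_of_le_of_lt (Nat.mul_le_mul_right _ (by omega)) hc)
    have hex : ∀ x, ∃ b : MvPolynomial (Fin d) (ZMod p), b.IsHomogeneous s ∧
        (x ∈ H → (∀ V ∈ Ws, x ∉ V ⊔ Submodule.span (ZMod p) {x0}) →
          quadPoly p d A ∣ F x0 - F x - ell A (x0 - x) * b) := by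
      intro x
      by_cases hx : x ∈ H ∧ ∀ V ∈ Ws, x ∉ V ⊔ Submodule.span (ZMod p) {x0}
      · obtain ⟨b, hb, hb2⟩ := extract s _ _ _ ((hF x0).sub (hF x)) (quad_homog A)
          (ell_homog A _)
          (h x0 hx0 x hx.1 (fun V hV => pair_of_notMem V x0 x (hx0W V hV) (hx.2 V hV)))
        exact ⟨b, hb, fun _ _ => hb2⟩
      · exact ⟨0, isHomogeneous_zero _ _ _, fun h1 h2 => absurd ⟨h1, h2⟩ hx⟩
    choose F' hF'1 hF'2 using hex
    obtain ⟨G', hG'1, hG'2, hG'3⟩ := ih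
      (Ws.map (fun V => V ⊔ Submodule.span (ZMod p) {x0})) F'
      (by simpa using hne)
      (by
        intro V hV
        obtain ⟨V', hV', rfl⟩ := List.mem_map.1 hV
        have := finrank_sup_span_le V' x0
        have := hW V' hV'
        omega)
      (by
        rw [List.length_map]
        exact lt_of_le_of_lt (Nat.mul_le_mul_right _ (by omega)) hc)
      hF'1
      (by
        intro x hx y hy hxy
        have hxy3 : ∀ V ∈ Ws, ∀ a b c : ZMod p, a • x + b • y - c • x0 ∈ V → a = 0 ∧ b = 0 := by
          intro V hV a b c habc
          exact hxy _ (List.mem_map.2 ⟨V, hV, rfl⟩) a b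
            ((mem_sup_span V x0 _).2 ⟨c, habc⟩)
        have hx' : ∀ V ∈ Ws, x ∉ V ⊔ Submodule.span (ZMod p) {x0} := by
          intro V hV hm
          have := hxy _ (List.mem_map.2 ⟨V, hV, rfl⟩) 1 0 (by simpa using hm)
          exact one_ne_zero this.1
        have hy' : ∀ V ∈ Ws, y ∉ V ⊔ Submodule.span (ZMod p) {x0} := by
          intro V hV hm
          have := hxy _ (List.mem_map.2 ⟨V, hV, rfl⟩) 0 1 (by simpa using hm)
          exact one_ne_zero this.2
        obtain ⟨c1, e1⟩ := hF'2 x hx hx'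
        obtain ⟨c2, e2⟩ := hF'2 y hy hy'
        have e3 := h x hx y hy (by
          intro V hV a b hab
          exact hxy3 V hV a b 0 (by simpa using hab))
        apply reg A hd h2 hA hdet (h := x - y) (h' := x0 - x)
        · intro a b hab
          obtain ⟨V, hV⟩ := List.exists_mem_of_ne_nil _ hne
          have := hxy3 V hV (a - b) (-a) (-b) (by
            have e : (a - b) • x + (-a) • y - (-b) • x0 = a • (x - y) + b • (x0 - x) := by
              module
            rw [e, hab]
            exact V.zero_mem)
          have ha : a = 0 := neg_eq_zero.1 this.2
          refine ⟨ha, ?_⟩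
          have := this.1
          rw [ha, zero_sub] at this
          exact neg_eq_zero.1 this
        · have e4 : ell A (x0 - x) * (F' x - F' y) =
              -(F x - F y) + ((c2 - c1) * quadPoly p d A + F' y * ell A (x - y)) := by
            rw [ell_sub] at e1 e2 ⊢
            rw [ell_sub]
            linear_combination e2 - e1
          rw [e4]
          exact Ideal.add_mem _ (Ideal.neg_mem_iff _ |>.2 e3)
            (Ideal.mem_span_pair.2 ⟨_, _, rfl⟩))
    let G : Polynomial (MvPolynomial (Fin d) (ZMod p)) :=
      Polynomial.C (F x0) + (Polynomial.X - Polynomial.C (ell A x0)) * G'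
    have hcS : ∀ i, G.coeff (i + 1) = G'.coeff i - ell A x0 * G'.coeff (i + 1) := by
      intro i
      simp [G, sub_mul, Polynomial.coeff_C_succ]
    have hc0 : G.coeff 0 = F x0 - ell A x0 * G'.coeff 0 := by
      simp [G, sub_mul, sub_eq_add_neg]
    have hG1 : ∀ i, (G.coeff i).IsHomogeneous (s + 1 - i) := by
      intro i
      cases i with
      | zero =>
        rw [hc0]
        apply (hF x0).sub
        have := (ell_homog A x0).mul (hG'1 0)
        rwa [Nat.sub_zero, add_comm] at this
      | succ i =>
        rw [hcS, Nat.add_sub_add_right]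
        apply (hG'1 i).sub
        by_cases hi : i + 1 ≤ s
        · have := (ell_homog A x0).mul (hG'1 (i + 1))
          rwa [show 1 + (s - (i + 1)) = s - i by omega] at this
        · rw [hG'2 (i + 1) (by omega), mul_zero]
          exact isHomogeneous_zero _ _ _
    have hG2 : ∀ i, s + 1 < i → G.coeff i = 0 := by
      intro i hi
      cases i with
      | zero => omega
      | succ i => rw [hcS, hG'2 i (by omega), hG'2 (i + 1) (by omega), mul_zero, sub_zero]
    refine ⟨G, hG1, hG2, ?_⟩
    apply extend A hd h2 hA hdet H (s + 1) Ws F hne hW hc hF h x0 G hG1 hG2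
    intro x hx hxW
    obtain ⟨c1, e1⟩ := hF'2 x hx hxW
    obtain ⟨c2, e2⟩ := hG'3 x hx (by
      intro V hV
      obtain ⟨V', hV', rfl⟩ := List.mem_map.1 hV
      exact hxW V' hV')
    refine ⟨-c1 + (ell A x - ell A x0) * c2, ?_⟩
    rw [ell_sub] at e1
    simp only [G, Polynomial.eval_add, Polynomial.eval_mul, Polynomial.eval_sub,
      Polynomial.eval_C, Polynomial.eval_X]
    linear_combination -e1 + (ell A x - ell A x0) * e2

end mainsec

/-- If `F(x) - F(y) ∈ J^M_{x-y}` for all suitably independent `x, y` in a dense set `H`,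
then `F(x) ≡ G(L_x) mod J^M` for a super polynomial `G : HP_d(1) → HP_d(s)`. -/
theorem stmt11 (d k s : ℕ) (hd : 1 ≤ d) (δ : ℝ) (hδ : 0 < δ) :
    ∃ p0 : ℕ, ∀ p : ℕ, p.Prime → p0 ≤ p →
    ∀ H : Finset (Fin d → ZMod p), δ * (p : ℝ) ^ d < (H.card : ℝ) →
    ∀ (M : (Fin d → ZMod p) → ZMod p) (A : Matrix (Fin d) (Fin d) (ZMod p))
      (uu : Fin d → ZMod p) (vv : ZMod p),
      IsQuadFormWith p d M A uu vv → A.det ≠ 0 →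
    ∀ U : Fin k → Submodule (ZMod p) (Fin d → ZMod p),
      (∀ i j, Module.finrank (ZMod p) (U i) = Module.finrank (ZMod p) (U j)) →
    ∀ F : (Fin d → ZMod p) → MvPolynomial (Fin d) (ZMod p),
      (∀ x, (F x).IsHomogeneous s) →
      (∀ x ∈ H, ∀ y ∈ H,
        (∀ i : Fin (k + 1),
          VecSubIndep p d ![x, y]
            ((Fin.cons ⊥ U : Fin (k + 1) → Submodule (ZMod p) (Fin d → ZMod p)) i) ⊥) →
        F x - F y ∈ JM p d A
          (Submodule.span (ZMod p) {x - y} : Set (Fin d → ZMod p))) →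
      s + Module.finrank (ZMod p)
          ((Fin.cons ⊥ U : Fin (k + 1) → Submodule (ZMod p) (Fin d → ZMod p)) (Fin.last k)) +
        8 ≤ d →
      ∃ Cc : Fin (s + 1) → MvPolynomial (Fin d) (ZMod p),
        (∀ i : Fin (s + 1), (Cc i).IsHomogeneous (s - (i : ℕ))) ∧
        ∀ x ∈ H,
          (∀ i : Fin (k + 1),
            VecSubIndep p d ![x]
              ((Fin.cons ⊥ U : Fin (k + 1) → Submodule (ZMod p) (Fin d → ZMod p)) i) ⊥) →
          F x - ∑ i : Fin (s + 1), Cc i * (lx p d A x) ^ (i : ℕ) ∈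
            JM p d A ((⊥ : Submodule (ZMod p) (Fin d → ZMod p)) : Set (Fin d → ZMod p)) := by
  refine ⟨max 3 ⌈((2 * (k + 1) + s : ℕ) : ℝ) / δ⌉₊, ?_⟩
  intro p hp hp0 H hH M A uu vv hM hdet U hU F hF h hdim
  haveI : Fact p.Prime := ⟨hp⟩
  have hp3 : 3 ≤ p := (le_max_left _ _).trans hp0
  have hpc : ((2 * (k + 1) + s : ℕ) : ℝ) / δ ≤ p :=
    (Nat.le_ceil _).trans (by exact_mod_cast (le_max_right _ _).trans hp0)
  have h2 : (2 : ZMod p) ≠ 0 := by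
    intro h0
    have : ((2 : ℕ) : ZMod p) = 0 := by exact_mod_cast h0
    rw [ZMod.natCast_eq_zero_iff] at this
    have := Nat.le_of_dvd (by norm_num) this
    omega
  have hcard : (2 * (k + 1) + s) * p ^ (d - 1) < H.card := by
    have e1 : ((2 * (k + 1) + s : ℕ) : ℝ) ≤ δ * p := by
      rw [div_le_iff₀ hδ] at hpc
      linarith
    have e2 : ((2 * (k + 1) + s : ℕ) : ℝ) * (p : ℝ) ^ (d - 1) < H.card := by
      refine lt_of_le_of_lt ?_ hH
      have e3 : (p : ℝ) ^ d = p * (p : ℝ) ^ (d - 1) := by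
        rw [← pow_succ', Nat.sub_add_cancel hd]
      rw [e3, ← mul_assoc]
      exact mul_le_mul_of_nonneg_right e1 (by positivity)
    exact_mod_cast e2
  let W : Fin (k + 1) → Submodule (ZMod p) (Fin d → ZMod p) := Fin.cons ⊥ U
  have hWdim : ∀ i, Module.finrank (ZMod p) (W i) ≤ Module.finrank (ZMod p) (W (Fin.last k)) := by
    intro i
    refine Fin.cases ?_ ?_ i
    · have e : Module.finrank (ZMod p) (W 0) = 0 := finrank_bot _ _
      rw [e]
      exact Nat.zero_le _
    · intro j
      cases k with
      | zero => exact j.elim0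
      | succ k =>
        rw [← Fin.succ_last]
        exact (hU j (Fin.last k)).le
  have hpair : ∀ (x y : Fin d → ZMod p) (V : Submodule (ZMod p) (Fin d → ZMod p)),
      (∀ a b : ZMod p, a • x + b • y ∈ V → a = 0 ∧ b = 0) → VecSubIndep p d ![x, y] V ⊥ := by
    intro x y V hV c u hu w hw hs
    rw [Submodule.mem_bot] at hw
    subst hw
    rw [Fin.sum_univ_two, add_zero] at hs
    have e := hV (c 0) (c 1) (by
      have : c 0 • x + c 1 • y = -u := eq_neg_of_add_eq_zero_left hs
      rw [this]
      exact V.neg_mem hu)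
    refine ⟨fun l => ?_, ?_, rfl⟩
    · fin_cases l
      · exact e.1
      · exact e.2
    · rw [e.1, e.2] at hs
      simpa using hs
  obtain ⟨G, hG1, hG2, hG3⟩ := mainlem A (by omega) h2 hM.1 hdet H s (List.ofFn W) F
    (by simp) (by
      intro V hV
      obtain ⟨i, rfl⟩ := (List.mem_ofFn' _ _).1 hV
      have := hWdim i
      change s + Module.finrank (ZMod p) (W (Fin.last k)) + 8 ≤ d at hdim
      omega) (by rw [List.length_ofFn]; exact hcard) hF (by
      intro x hx y hy hxy
      rw [← JM_span]
      apply h x hx y hy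
      intro i
      exact hpair x y (W i) (hxy (W i) ((List.mem_ofFn' _ _).2 ⟨i, rfl⟩)))
  refine ⟨fun i => G.coeff i, fun i => hG1 i, ?_⟩
  intro x hx hxU
  apply mem_JM_bot
  have hm := hG3 x hx (by
    intro V hV hxV
    obtain ⟨i, rfl⟩ := (List.mem_ofFn' _ _).1 hV
    have := (hxU i (fun _ => 1) (-x) ((W i).neg_mem hxV) 0 (Submodule.zero_mem _) (by simp)).1 0
    exact one_ne_zero this)
  rw [Polynomial.eval_eq_sum_range' (n := s + 1)
    (Nat.lt_succ_iff.2 (Polynomial.natDegree_le_iff_coeff_eq_zero.2 hG2))] at hm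
  rw [lx_eq A hM.1, Fin.sum_univ_eq_sum_range (fun i => G.coeff i * ell A x ^ i)]
  exact hm
end
end

section
/- Let d, k ≥ 1 be integers, s ∈ ℕ, and δ > 0. There exists a threshold p_0 depending only on δ and d such that for every prime p ≥ p_0 the following holds. Let U be a subspace of 𝔽_p^d, let H ⊆ 𝔽_p^d with |H| > δ·p^d, let M : 𝔽_p^d → 𝔽_p be a non-degenerate quadratic form, and let F : HP_d(1)^k → HP_d(s) be a super polynomial given by F(f_1,…,f_k) = Σ_{i ∈ ℕ^k, |i| ≤ s} C_i·f_1^{i_1}⋯f_k^{i_k} with C_i ∈ HP_d(s−|i|). Suppose F(L_{x_1},…,L_{x_k}) ∈ J^M for all x_1, …, x_k ∈ H such that the tuple (x_1,…,x_k, U) is linearly independent. If d ≥ max{s+1, dim(U)+k, 7}, then C_i ∈ J^M for every i ∈ ℕ^k with |i| ≤ s. -/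
noncomputable section

open MvPolynomial

namespace Stmt12Aux

theorem affine {K : Type*} [Field K] {d : ℕ} (f : MvPolynomial (Fin d) K)
    (hf : f.totalDegree ≤ 1) :
    ∃ l : (Fin d → K) →ₗ[K] K, ∀ x v, eval (x + v) f = eval x f + l v := by
  refine ⟨∑ m ∈ f.support, f.coeff m • ∑ i, (m i : K) • LinearMap.proj i, fun x v => ?_⟩
  rw [eval_eq', eval_eq', LinearMap.sum_apply, ← Finset.sum_add_distrib]
  refine Finset.sum_congr rfl fun m hm => ?_
  have hdeg : m.degree ≤ 1 := by
    have := le_totalDegree hm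
    rw [Finsupp.degree_eq_sum]
    rw [Finsupp.sum_fintype _ _ (by simp)] at this
    omega
  have : m = 0 ∨ ∃ i, m = Finsupp.single i 1 := by
    rcases Nat.le_one_iff_eq_zero_or_eq_one.mp hdeg with h | h
    · left; exact (Finsupp.degree_eq_zero_iff m).mp h
    · right
      have hne : m ≠ 0 := by rintro rfl; simp at h
      obtain ⟨i, hi⟩ := Finsupp.ne_iff.mp hne
      refine ⟨i, ?_⟩
      rw [Finsupp.degree_eq_sum, ← Finset.add_sum_erase _ _ (Finset.mem_univ i)] at h
      have hi' : m i ≠ 0 := hi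
      have h0 : ∑ j ∈ Finset.univ.erase i, m j = 0 := by omega
      have h1 : m i = 1 := by omega
      rw [Finset.sum_eq_zero_iff] at h0
      ext j
      by_cases hj : j = i
      · subst hj; simp [h1]
      · rw [h0 j (by simp [hj])]
        simp [Ne.symm hj]
  rw [LinearMap.smul_apply, smul_eq_mul, ← mul_add]
  congr 1
  rcases this with rfl | ⟨i, rfl⟩
  · simp
  · have key : ∀ y : Fin d → K, ∏ j, y j ^ (Finsupp.single i 1 : Fin d →₀ ℕ) j = y i := by
      intro y
      rw [Finset.prod_eq_single i]
      · simp
      · intro j _ hj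
        simp [Finsupp.single_apply, hj.symm]
      · simp
    rw [key, key, LinearMap.sum_apply, Finset.sum_eq_single i]
    · simp
    · intro j _ hj
      simp [Finsupp.single_apply, hj.symm]
    · simp

theorem eval_quad (p d : ℕ) (A : Matrix (Fin d) (Fin d) (ZMod p)) (x : Fin d → ZMod p) :
    eval x (quadPoly p d A) = x ⬝ᵥ A.mulVec x := by
  simp only [quadPoly, map_sum, map_mul, eval_C, eval_X, dotProduct, Matrix.mulVec,
    Finset.mul_sum]
  refine Finset.sum_congr rfl fun i _ => Finset.sum_congr rfl fun j _ => by ring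

theorem inv_zero (p d : ℕ) [Fact p.Prime] (h2 : 2 < p) (A : Matrix (Fin d) (Fin d) (ZMod p))
    (hA : A.IsSymm) (hdet : A.det ≠ 0) (v : Fin d → ZMod p)
    (h : ∀ x, eval (x + v) (quadPoly p d A) = eval x (quadPoly p d A)) : v = 0 := by
  have h2' : (2 : ZMod p) ≠ 0 := by
    intro h
    have : ((2 : ℕ) : ZMod p) = 0 := by exact_mod_cast h
    rw [ZMod.natCast_eq_zero_iff] at this
    exact absurd (Nat.le_of_dvd (by norm_num) this) (by omega)
  by_contra hv
  have hAv : A.mulVec v = 0 := by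
    have h0 := h 0
    simp only [eval_quad, zero_add, zero_dotProduct] at h0
    refine dotProduct_eq_zero _ fun x => ?_
    have hx := h x
    simp only [eval_quad, Matrix.mulVec_add, add_dotProduct, dotProduct_add, h0] at hx
    have hs : v ⬝ᵥ A.mulVec x = x ⬝ᵥ A.mulVec v := by
      rw [Matrix.dotProduct_mulVec, ← Matrix.mulVec_transpose, hA.eq, dotProduct_comm]
    rw [hs] at hx
    have : 2 * (x ⬝ᵥ A.mulVec v) = 0 := by linear_combination hx
    rw [dotProduct_comm]
    exact (mul_eq_zero.mp this).resolve_left h2'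
  exact hdet (Matrix.exists_mulVec_eq_zero_iff.mp ⟨v, hv, hAv⟩)

theorem quad_hom (p d : ℕ) (A : Matrix (Fin d) (Fin d) (ZMod p)) :
    (quadPoly p d A).IsHomogeneous 2 := by
  refine IsHomogeneous.sum _ _ _ fun i _ => IsHomogeneous.sum _ _ _ fun j _ => ?_
  have := (isHomogeneous_C (Fin d) (A i j)).mul ((isHomogeneous_X (ZMod p) i).mul
    (isHomogeneous_X (ZMod p) j))
  simpa using this

theorem quad_ne (p d : ℕ) [Fact p.Prime] (h2 : 2 < p) (hd : 3 ≤ d)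
    (A : Matrix (Fin d) (Fin d) (ZMod p))
    (hA : A.IsSymm) (hdet : A.det ≠ 0) : quadPoly p d A ≠ 0 := by
  intro h
  have := inv_zero p d h2 A hA hdet (fun _ => 1) (by simp [h])
  have := congrFun this ⟨0, by omega⟩
  simp at this

theorem quad_prime (p d : ℕ) [Fact p.Prime] (h2 : 2 < p) (hd : 3 ≤ d)
    (A : Matrix (Fin d) (Fin d) (ZMod p))
    (hA : A.IsSymm) (hdet : A.det ≠ 0) : Prime (quadPoly p d A) := by
  have hne := quad_ne p d h2 hd A hA hdet
  have hdeg := (quad_hom p d A).totalDegree hne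
  refine Irreducible.prime ⟨fun hu => ?_, fun f g hfg => ?_⟩
  · have := (MvPolynomial.isUnit_iff_totalDegree_of_isReduced.mp hu).2
    omega
  · have hf0 : f ≠ 0 := by rintro rfl; simp at hfg; exact hne hfg
    have hg0 : g ≠ 0 := by rintro rfl; simp at hfg; exact hne hfg
    have hsum : f.totalDegree + g.totalDegree = 2 := by
      rw [← totalDegree_mul_of_isDomain hf0 hg0, ← hfg, hdeg]
    have hunit : ∀ f : MvPolynomial (Fin d) (ZMod p), f ≠ 0 → f.totalDegree = 0 → IsUnit f := by
      intro f hf h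
      rw [totalDegree_eq_zero_iff_eq_C] at h
      rw [h] at hf ⊢
      refine (IsUnit.mk0 _ ?_).map C
      intro h0
      rw [h0] at hf
      simp at hf
    by_contra hcon
    push Not at hcon
    have hf1 : f.totalDegree ≠ 0 := fun h => hcon.1 (hunit f hf0 h)
    have hg1 : g.totalDegree ≠ 0 := fun h => hcon.2 (hunit g hg0 h)
    obtain ⟨l, hl⟩ := affine f (by omega)
    obtain ⟨m, hm⟩ := affine g (by omega)
    have hker : LinearMap.ker (l.prod m) ≠ ⊥ := LinearMap.ker_ne_bot_of_finrank_lt (by simp; omega)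
    obtain ⟨v, hv, hv0⟩ := Submodule.exists_mem_ne_zero_of_ne_bot hker
    have hv' : l v = 0 ∧ m v = 0 := by simpa [LinearMap.mem_ker] using hv
    refine hv0 (inv_zero p d h2 A hA hdet v fun x => ?_)
    rw [hfg, map_mul, map_mul, hl, hm, hv'.1, hv'.2, add_zero, add_zero]

theorem JM_bot (p d : ℕ) (A : Matrix (Fin d) (Fin d) (ZMod p)) :
    JM p d A ((⊥ : Submodule (ZMod p) (Fin d → ZMod p)) : Set (Fin d → ZMod p))
      = Ideal.span {quadPoly p d A} := by
  have : linPoly p d A 0 = 0 := by simp [linPoly]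
  rw [JM, Submodule.bot_coe, Set.image_singleton, this, Ideal.span_union]
  simp

theorem lx_sub (p d : ℕ) (A : Matrix (Fin d) (Fin d) (ZMod p)) (x y : Fin d → ZMod p) :
    lx p d A x - lx p d A y = lx p d A (x - y) := by
  simp only [lx, ← Finset.sum_sub_distrib, ← sub_mul, ← map_sub, Pi.sub_apply, mul_sub]

theorem lx_inj (p d : ℕ) [Fact p.Prime] (h2 : 2 < p) (hd : 3 ≤ d)
    (A : Matrix (Fin d) (Fin d) (ZMod p))
    (hA : A.IsSymm) (hdet : A.det ≠ 0) (v : Fin d → ZMod p)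
    (h : quadPoly p d A ∣ lx p d A v) : v = 0 := by
  have hne := quad_ne p d h2 hd A hA hdet
  have hdeg := (quad_hom p d A).totalDegree hne
  have hle : (lx p d A v).totalDegree ≤ 1 := by
    refine IsHomogeneous.totalDegree_le (IsHomogeneous.sum _ _ _ fun i _ => ?_)
    have := (isHomogeneous_C (Fin d) (∑ j, A i j * v j)).mul (isHomogeneous_X (ZMod p) i)
    simpa using this
  have h0 : lx p d A v = 0 := by
    obtain ⟨g, hg⟩ := h
    by_contra hn
    have hg0 : g ≠ 0 := by rintro rfl; simp at hg; exact hn hg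
    rw [hg, totalDegree_mul_of_isDomain hne hg0] at hle
    omega
  by_contra hv
  refine hdet (Matrix.exists_mulVec_eq_zero_iff.mp ⟨v, hv, ?_⟩)
  refine dotProduct_eq_zero _ fun x => ?_
  have := congrArg (eval x) h0
  simpa [lx, dotProduct, Matrix.mulVec] using this

theorem main_ind (p d s : ℕ) [Fact p.Prime] {R : Type*} [CommRing R] [IsDomain R]
    (L : (Fin d → ZMod p) → R) (hL : Function.Injective L)
    (H : Finset (Fin d → ZMod p))
    (hH : ∀ W : Submodule (ZMod p) (Fin d → ZMod p), Module.finrank (ZMod p) W < d →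
      ∃ T ⊆ H, (∀ x ∈ T, x ∉ W) ∧ s < T.card) (k : ℕ) :
    ∀ (U : Submodule (ZMod p) (Fin d → ZMod p)) (c : (Fin k → Fin (s + 1)) → R),
      Module.finrank (ZMod p) U + k ≤ d →
      (∀ x : Fin k → Fin d → ZMod p, (∀ j, x j ∈ H) → VecSubIndep p d x U ⊥ →
        ∑ i, c i * ∏ j, L (x j) ^ (i j : ℕ) = 0) → ∀ i, c i = 0 := by
  induction k with
  | zero =>
    intro U c _ h i
    have := h (fun j => j.elim0) (fun j => j.elim0) (by
      intro c u hu w hw h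
      rw [Submodule.mem_bot] at hw
      subst hw
      simp at h
      exact ⟨fun j => j.elim0, h, rfl⟩)
    simp at this
    rw [← this]
    congr 1
    exact Subsingleton.elim _ _
  | succ k ih =>
    intro U c hdim h i
    obtain ⟨T, hTH, hTU, hTs⟩ := hH U (by omega)
    have step : ∀ x0 ∈ T, ∀ i' : Fin k → Fin (s + 1),
        ∑ a : Fin (s + 1), c (Fin.cons a i' : Fin (k + 1) → Fin (s + 1)) * L x0 ^ (a : ℕ) = 0 := by
      intro x0 hx0
      refine ih (U ⊔ Submodule.span (ZMod p) {x0})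
        (fun i' => ∑ a : Fin (s + 1),
          c (Fin.cons a i' : Fin (k + 1) → Fin (s + 1)) * L x0 ^ (a : ℕ)) ?_ ?_
      · have h1 := Submodule.finrank_add_le_finrank_add_finrank U (Submodule.span (ZMod p) {x0})
        have h2 := finrank_span_finset_le_card (R := ZMod p) {x0}
        rw [Finset.coe_singleton, Finset.card_singleton, Set.finrank] at h2
        omega
      · intro x hx hind
        have := h (Fin.cons x0 x : Fin (k + 1) → Fin d → ZMod p) (by
          intro j
          refine Fin.cases ?_ ?_ j
          · simpa using hTH hx0
          · intro j; simpa using hx j) (by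
          intro c u hu w hw hs
          rw [Submodule.mem_bot] at hw
          subst hw
          rw [Fin.sum_univ_succ] at hs
          simp only [Fin.cons_zero, Fin.cons_succ, add_zero] at hs
          have h1 := hind (fun j => c j.succ) (u + c 0 • x0)
            (Submodule.add_mem_sup hu (Submodule.smul_mem _ _ (Submodule.mem_span_singleton_self _)))
            0 (by simp) (by refine Eq.trans ?_ hs; abel)
          have hc0 : c 0 = 0 := by
            by_contra hc
            refine hTU x0 hx0 ?_
            have : x0 = (c 0)⁻¹ • (-u) := by
              rw [eq_inv_smul_iff₀ hc]
              exact eq_neg_of_add_eq_zero_right h1.2.1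
            rw [this]
            exact U.smul_mem _ (U.neg_mem hu)
          refine ⟨fun j => Fin.cases hc0 h1.1 j, ?_, rfl⟩
          simpa [hc0] using h1.2.1)
        refine Eq.trans ?_ this
        rw [← (Fin.consEquiv fun _ => Fin (s + 1)).sum_comp, Fintype.sum_prod_type,
          Finset.sum_comm]
        refine Finset.sum_congr rfl fun i' _ => ?_
        rw [Finset.sum_mul]
        refine Finset.sum_congr rfl fun a _ => ?_
        rw [Fin.prod_univ_succ]
        simp [Fin.consEquiv]
        ring
    let P : Polynomial R := ∑ a : Fin (s + 1),
      Polynomial.monomial (a : ℕ) (c (Fin.cons a (Fin.tail i) : Fin (k + 1) → Fin (s + 1)))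
    have hP : P = 0 := by
      refine Polynomial.eq_zero_of_natDegree_lt_card_of_eval_eq_zero P
        (f := fun x : T => L x.1) (fun x y hxy => Subtype.ext (hL hxy)) (fun x => ?_) ?_
      · simp only [P, Polynomial.eval_finsetSum, Polynomial.eval_monomial]
        exact step x.1 x.2 _
      · rw [Fintype.card_coe]
        refine lt_of_le_of_lt ?_ hTs
        refine Polynomial.natDegree_sum_le_of_forall_le _ _ fun a _ => ?_
        exact (Polynomial.natDegree_monomial_le _).trans (by omega)
    have hc := congrArg (fun Q => Polynomial.coeff Q (i 0 : ℕ)) hP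
    simp only [P, Polynomial.finsetSum_coeff, Polynomial.coeff_monomial, Polynomial.coeff_zero,
      Fin.val_inj] at hc
    simpa using hc

end Stmt12Aux

/-- If a super polynomial `F` with coefficients `Cc` vanishes modulo `J^M` on all tuples
`(L_{x_1}, …, L_{x_k})` with `x_j ∈ H` and `(x_1,…,x_k,U)` linearly independent, then all
its coefficients lie in `J^M`. -/
theorem stmt12 (d k s : ℕ) (hd : 1 ≤ d) (hk : 1 ≤ k) (δ : ℝ) (hδ : 0 < δ) :
    ∃ p0 : ℕ, ∀ p : ℕ, p.Prime → p0 ≤ p →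
    ∀ (U : Submodule (ZMod p) (Fin d → ZMod p)) (H : Finset (Fin d → ZMod p)),
      δ * (p : ℝ) ^ d < (H.card : ℝ) →
    ∀ (M : (Fin d → ZMod p) → ZMod p) (A : Matrix (Fin d) (Fin d) (ZMod p))
      (uu : Fin d → ZMod p) (vv : ZMod p),
      IsQuadFormWith p d M A uu vv → A.det ≠ 0 →
    ∀ Cc : (Fin k → ℕ) → MvPolynomial (Fin d) (ZMod p),
      (∀ i : Fin k → ℕ, (∑ j, i j) ≤ s → (Cc i).IsHomogeneous (s - ∑ j, i j)) →
      (∀ x : Fin k → Fin d → ZMod p, (∀ j, x j ∈ H) →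
        VecSubIndep p d x U ⊥ →
        (∑ i ∈ Finset.univ.filter (fun i : Fin k → Fin (s + 1) => (∑ j, (i j : ℕ)) ≤ s),
            Cc (fun j => (i j : ℕ)) * ∏ j : Fin k, (lx p d A (x j)) ^ ((i j : ℕ))) ∈
          JM p d A ((⊥ : Submodule (ZMod p) (Fin d → ZMod p)) : Set (Fin d → ZMod p))) →
      (max (s + 1) (max (Module.finrank (ZMod p) U + k) 7) ≤ d) →
      ∀ i : Fin k → ℕ, (∑ j, i j) ≤ s →
        Cc i ∈ JM p d A ((⊥ : Submodule (ZMod p) (Fin d → ZMod p)) : Set (Fin d → ZMod p)) := by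
  obtain ⟨N, hN⟩ := exists_nat_gt ((2 * (s + 1) + 2) / δ)
  refine ⟨N + 3, fun p hp hpN U H hH M A uu vv hM hdet Cc _ hF hmax => ?_⟩
  have : Fact p.Prime := ⟨hp⟩
  have hd7 : 7 ≤ d := by omega
  have hA := hM.1
  have hprime := Stmt12Aux.quad_prime p d (by omega) (by omega) A hA hdet
  rw [Stmt12Aux.JM_bot] at hF ⊢
  set J := Ideal.span {quadPoly p d A} with hJ
  have hJp : J.IsPrime := (Ideal.span_singleton_prime hprime.ne_zero).mpr hprime
  have hL : Function.Injective fun x => Ideal.Quotient.mk J (lx p d A x) := by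
    intro x y hxy
    have h1 := (Ideal.Quotient.mk_eq_mk_iff_sub_mem _ _).mp hxy
    rw [Stmt12Aux.lx_sub, hJ, Ideal.mem_span_singleton] at h1
    exact sub_eq_zero.mp (Stmt12Aux.lx_inj p d (by omega) (by omega) A hA hdet _ h1)
  have hcount : ∀ W : Submodule (ZMod p) (Fin d → ZMod p), Module.finrank (ZMod p) W < d →
      ∃ T ⊆ H, (∀ x ∈ T, x ∉ W) ∧ s < T.card := by
    classical
    intro W hW
    refine ⟨H.filter (fun x => x ∉ W), Finset.filter_subset _ _, by simp, ?_⟩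
    have hcW : (H.filter (fun x => x ∈ W)).card ≤ p ^ (d - 1) := by
      have h1 : (H.filter (fun x => x ∈ W)).card ≤ Fintype.card W := by
        rw [Fintype.card_subtype]
        exact Finset.card_le_card fun x hx => by simpa using (Finset.mem_filter.mp hx).2
      rw [Module.card_eq_pow_finrank (K := ZMod p), ZMod.card] at h1
      exact h1.trans (Nat.pow_le_pow_right hp.pos (by omega))
    have hsum := Finset.card_filter_add_card_filter_not (s := H) (fun x => x ∈ W)
    have hpN' : (N : ℝ) ≤ p := by exact_mod_cast (by omega : N ≤ p)
    have hδp : 2 * ((s : ℝ) + 1) + 2 < δ * p := by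
      have := hN.trans_le hpN'
      rw [div_lt_iff₀ hδ] at this
      linarith
    have hq : (1 : ℝ) ≤ (p : ℝ) ^ (d - 1) :=
      one_le_pow₀ (by exact_mod_cast hp.one_lt.le)
    have hpd : (p : ℝ) ^ d = p ^ (d - 1) * p := by
      rw [← pow_succ]; congr 1; omega
    have hcW' : ((H.filter (fun x => x ∈ W)).card : ℝ) ≤ (p : ℝ) ^ (d - 1) := by
      exact_mod_cast hcW
    have hsum' : ((H.filter (fun x => x ∈ W)).card : ℝ)
        + ((H.filter (fun x => x ∉ W)).card : ℝ) = H.card := by exact_mod_cast hsum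
    have : (s : ℝ) < ((H.filter (fun x => x ∉ W)).card : ℝ) := by
      rw [hpd] at hH
      nlinarith [mul_le_mul_of_nonneg_left hδp.le (by linarith : (0 : ℝ) ≤ (p : ℝ) ^ (d - 1)),
        (Nat.cast_nonneg s : (0 : ℝ) ≤ s)]
    exact_mod_cast this
  intro i hi
  have key := Stmt12Aux.main_ind p d s (fun x => Ideal.Quotient.mk J (lx p d A x)) hL H hcount k U
    (fun i => if (∑ j, (i j : ℕ)) ≤ s then Ideal.Quotient.mk J (Cc (fun j => (i j : ℕ))) else 0)
    (by omega) (by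
      intro x hx hind
      have := Ideal.Quotient.eq_zero_iff_mem.mpr (hF x hx hind)
      refine Eq.trans ?_ this
      rw [map_sum, Finset.sum_filter]
      refine Finset.sum_congr rfl fun i _ => ?_
      split_ifs
      · simp
      · simp)
  have hlt : ∀ j, i j < s + 1 := fun j =>
    Nat.lt_succ_of_le ((Finset.single_le_sum (f := i) (fun _ _ => Nat.zero_le _)
      (Finset.mem_univ j)).trans hi)
  have := key (fun j => ⟨i j, hlt j⟩)
  simp only [hi, if_true] at this
  exact Ideal.Quotient.eq_zero_iff_mem.mp this
end
end

section
/- Let d ≥ 1 be an integer, s ∈ ℕ, and δ > 0. There exists a threshold p_0 depending only on δ and d such that for every prime p ≥ p_0 the following holds. Let H ⊆ 𝔽_p^d with |H| > δ·p^d, let U be a subspace of 𝔽_p^d, and let M : 𝔽_p^d → 𝔽_p be a non-degenerate quadratic form. Suppose that for every pair x, y ∈ H for which the tuple (x, y, U) is linearly independent we are given an element C(x,y) ∈ HP_d(s), and that C(x,y) + C(y,z) − C(x,z) ∈ J^M_{x−y, y−z} for all x, y, z ∈ H such that the tuple (x, y, z, U) is linearly independent. If d ≥ s + dim(U) + 9,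 then there exist elements φ(x) ∈ HP_d(s), one for each x ∈ H with (x, U) linearly independent, such that C(x,y) − (φ(x) − φ(y)) ∈ J^M_{x−y} for all x, y ∈ H with the tuple (x, y, U) linearly independent. -/
noncomputable section

open MvPolynomial

namespace S13

section part1
set_option linter.unusedSectionVars false
variable {p : ℕ} [Fact p.Prime]

def lf {n : ℕ} (a : Fin n → ZMod p) : MvPolynomial (Fin n) (ZMod p) :=
  ∑ j, MvPolynomial.C (a j) * MvPolynomial.X j

def sb {m n : ℕ} (N : Matrix (Fin m) (Fin n) (ZMod p)) :
    MvPolynomial (Fin m) (ZMod p) →ₐ[ZMod p] MvPolynomial (Fin n) (ZMod p) :=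
  MvPolynomial.aeval (fun i => lf (N i))

lemma lf_add {n : ℕ} (a b : Fin n → ZMod p) : lf (a + b) = lf a + lf b := by
  simp [lf, add_mul, Finset.sum_add_distrib]

lemma lf_sub {n : ℕ} (a b : Fin n → ZMod p) : lf (a - b) = lf a - lf b := by
  simp [lf, sub_mul, Finset.sum_sub_distrib]

lemma sb_lf {m n : ℕ} (N : Matrix (Fin m) (Fin n) (ZMod p)) (a : Fin m → ZMod p) :
    sb N (lf a) = lf (Matrix.vecMul a N) := by
  simp only [lf, sb, map_sum, map_mul, MvPolynomial.aeval_X, Matrix.vecMul, dotProduct,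
    MvPolynomial.aeval_C, MvPolynomial.algebraMap_eq, Finset.mul_sum, Finset.sum_mul]
  rw [Finset.sum_comm]
  simp [mul_assoc]

lemma lf_one {n : ℕ} (j : Fin n) : lf ((1 : Matrix (Fin n) (Fin n) (ZMod p)) j) =
    MvPolynomial.X j := by
  rw [lf, Finset.sum_eq_single j]
  · simp
  · intro b _ hb
    simp [Matrix.one_apply_ne' hb]
  · simp

lemma eval_lf {n : ℕ} (a t : Fin n → ZMod p) : MvPolynomial.eval t (lf a) = a ⬝ᵥ t := by
  simp [lf, dotProduct]

lemma eval_sb {m n : ℕ} (N : Matrix (Fin m) (Fin n) (ZMod p)) (t : Fin n → ZMod p)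
    (f : MvPolynomial (Fin m) (ZMod p)) :
    MvPolynomial.eval t (sb N f) = MvPolynomial.eval (Matrix.mulVec N t) f := by
  have : (MvPolynomial.aeval t).comp (sb N) =
      (MvPolynomial.aeval (Matrix.mulVec N t) : _ →ₐ[ZMod p] ZMod p) := by
    apply MvPolynomial.algHom_ext
    intro i
    simp [sb, MvPolynomial.aeval_eq_eval, eval_lf, Matrix.mulVec]
  exact DFunLike.congr_fun this f

lemma linPoly_eq {d : ℕ} (A : Matrix (Fin d) (Fin d) (ZMod p)) (h : Fin d → ZMod p) :
    linPoly p d A h = lf (Matrix.vecMul h A) := by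
  simp [linPoly, lf, Matrix.vecMul, dotProduct]

lemma eval_quad {d : ℕ} (A : Matrix (Fin d) (Fin d) (ZMod p)) (t : Fin d → ZMod p) :
    MvPolynomial.eval t (quadPoly p d A) = Matrix.toBilin' A t t := by
  simp only [quadPoly, Matrix.toBilin'_apply, map_sum, map_mul, MvPolynomial.eval_X,
    MvPolynomial.eval_C]
  refine Finset.sum_congr rfl fun i _ => Finset.sum_congr rfl fun j _ => by ring

lemma lf_hom {n : ℕ} (a : Fin n → ZMod p) : (lf a).IsHomogeneous 1 := by
  apply MvPolynomial.IsHomogeneous.sum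
  intro i _
  exact MvPolynomial.isHomogeneous_C_mul_X _ _

lemma quad_hom {d : ℕ} (A : Matrix (Fin d) (Fin d) (ZMod p)) :
    (quadPoly p d A).IsHomogeneous 2 := by
  apply MvPolynomial.IsHomogeneous.sum
  intro i _
  apply MvPolynomial.IsHomogeneous.sum
  intro j _
  exact ((MvPolynomial.isHomogeneous_X _ _).mul (MvPolynomial.isHomogeneous_X _ _)).C_mul _

lemma isotropic {d : ℕ} (hp : p ≠ 2) (A : Matrix (Fin d) (Fin d) (ZMod p)) (hA : A.IsSymm)
    (hdet : A.det ≠ 0) (W : Submodule (ZMod p) (Fin d → ZMod p))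
    (hW : ∀ w ∈ W, Matrix.toBilin' A w w = 0) : 2 * Module.finrank (ZMod p) W ≤ d := by
  have hnd := LinearMap.BilinForm.nondegenerate_toBilin'_of_det_ne_zero' A hdet
  have hsymm : ∀ x y, Matrix.toBilin' A x y = Matrix.toBilin' A y x := by
    intro x y
    rw [Matrix.toBilin'_apply', Matrix.toBilin'_apply', Matrix.dotProduct_mulVec,
      ← Matrix.mulVec_transpose, hA.eq, dotProduct_comm]
  have h2 : (2 : ZMod p) ≠ 0 := by
    intro h
    have : ((2 : ℕ) : ZMod p) = 0 := by exact_mod_cast h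
    rw [ZMod.natCast_eq_zero_iff] at this
    have := (Nat.prime_dvd_prime_iff_eq (Fact.out : p.Prime) Nat.prime_two).1 this
    exact hp this
  have hle : W ≤ LinearMap.BilinForm.orthogonal (Matrix.toBilin' A) W := by
    intro x hx y hy
    have := hW (x + y) (W.add_mem hx hy)
    simp only [map_add, LinearMap.add_apply, hW x hx, hW y hy] at this
    rw [hsymm x y] at this
    have h3 : 2 * Matrix.toBilin' A y x = 0 := by linear_combination this
    exact (mul_eq_zero.1 h3).resolve_left h2
  have h1 := Submodule.finrank_mono hle
  rw [LinearMap.BilinForm.finrank_orthogonal hnd] at h1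
  have h4 := Submodule.finrank_le W
  simp only [Module.finrank_fin_fun] at h1 h4
  omega

lemma eval_deg_one {n : ℕ} (a : MvPolynomial (Fin n) (ZMod p)) (ha : a.totalDegree ≤ 1)
    (h0 : MvPolynomial.eval 0 a = 0) : ∃ b : Fin n → ZMod p, a = lf b := by
  have h1 : MvPolynomial.homogeneousComponent 1 a = a := by
    conv_rhs => rw [← MvPolynomial.sum_homogeneousComponent a]
    have : MvPolynomial.homogeneousComponent 0 a = 0 := by
      rw [MvPolynomial.homogeneousComponent_zero, ← MvPolynomial.constantCoeff_eq,
        ← MvPolynomial.eval_zero, h0, map_zero]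
    interval_cases h : a.totalDegree
    · rw [MvPolynomial.homogeneousComponent_eq_zero 1 a (by omega)]
      simp [this]
    · simp [Finset.sum_range_succ, this]
  have h2 : a ∈ MvPolynomial.homogeneousSubmodule (Fin n) (ZMod p) 1 := by
    rw [← h1]; exact MvPolynomial.homogeneousComponent_mem _ _
  rw [MvPolynomial.homogeneousSubmodule_one_eq_span_X] at h2
  obtain ⟨c, hc⟩ := (Submodule.mem_span_range_iff_exists_fun _).1 h2
  exact ⟨c, by rw [← hc]; simp [lf, MvPolynomial.smul_eq_C_mul]⟩

lemma irred {d n : ℕ} (hp : p ≠ 2) (A : Matrix (Fin d) (Fin d) (ZMod p)) (hA : A.IsSymm)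
    (hdet : A.det ≠ 0) (N : Matrix (Fin d) (Fin n) (ZMod p))
    (hN : Function.Injective (Matrix.mulVecLin N)) (hn : d + 2 < 2 * n) :
    Irreducible (sb N (quadPoly p d A)) := by
  have key : ∀ b : Fin n → ZMod p,
      (∀ t, b ⬝ᵥ t = 0 → MvPolynomial.eval t (sb N (quadPoly p d A)) = 0) → False := by
    intro b hb
    let φ : (Fin n → ZMod p) →ₗ[ZMod p] ZMod p := dotProductBilin (ZMod p) (ZMod p) b
    have h1 := isotropic hp A hA hdet ((LinearMap.ker φ).map (Matrix.mulVecLin N)) (by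
      rintro w ⟨t, ht, rfl⟩
      have := hb t ht
      rwa [eval_sb, eval_quad] at this)
    rw [← (Submodule.equivMapOfInjective _ hN (LinearMap.ker φ)).finrank_eq] at h1
    have h2 := LinearMap.finrank_range_add_finrank_ker φ
    have h3 := Submodule.finrank_le (LinearMap.range φ)
    simp only [Module.finrank_fin_fun, Module.finrank_self] at h2 h3
    omega
  have hz : MvPolynomial.eval 0 (sb N (quadPoly p d A)) = 0 := by
    rw [eval_sb, eval_quad]; simp
  have hq0 : sb N (quadPoly p d A) ≠ 0 := by
    intro h
    exact key 0 (by simp [h])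
  have hdeg : (sb N (quadPoly p d A)).totalDegree ≤ 2 := by
    have : (sb N (quadPoly p d A)).IsHomogeneous (1 * 2) :=
      (quad_hom A).aeval _ (fun i => lf_hom _)
    simpa using this.totalDegree_le
  refine ⟨?_, ?_⟩
  · intro hu
    have := hu.map (MvPolynomial.eval 0)
    rw [hz] at this
    exact not_isUnit_zero this
  · intro a b hab
    have ha0 : a ≠ 0 := by rintro rfl; simp at hab; exact hq0 hab
    have hb0 : b ≠ 0 := by rintro rfl; simp at hab; exact hq0 hab
    have hu : ∀ a : MvPolynomial (Fin n) (ZMod p), a ≠ 0 → a.totalDegree = 0 → IsUnit a := by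
      intro a h0 h
      rw [MvPolynomial.totalDegree_eq_zero_iff_eq_C] at h
      rw [h]
      apply IsUnit.map
      rw [isUnit_iff_ne_zero]
      intro h'
      rw [h'] at h
      simp at h
      exact h0 h
    have hs := MvPolynomial.totalDegree_mul_of_isDomain ha0 hb0
    rw [← hab] at hs
    by_contra! hcon
    have h1 : a.totalDegree ≠ 0 := fun h => hcon.1 (hu a ha0 h)
    have h2 : b.totalDegree ≠ 0 := fun h => hcon.2 (hu b hb0 h)
    rw [hab, map_mul] at hz
    rcases mul_eq_zero.1 hz with h | h
    · obtain ⟨c, rfl⟩ := eval_deg_one a (by omega) h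
      refine key c fun t ht => ?_
      rw [hab, map_mul, eval_lf, ht, zero_mul]
    · obtain ⟨c, rfl⟩ := eval_deg_one b (by omega) h
      refine key c fun t ht => ?_
      rw [hab, map_mul, eval_lf, ht, mul_zero]

lemma lin_mem {d : ℕ} (A : Matrix (Fin d) (Fin d) (ZMod p))
    (V : Set (Fin d → ZMod p)) {h} (hh : h ∈ V) :
    linPoly p d A h ∈ JM p d A V :=
  Ideal.subset_span (Or.inr ⟨h, hh, rfl⟩)

lemma orth {d : ℕ} (A : Matrix (Fin d) (Fin d) (ZMod p)) (hA : A.IsSymm)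
    (hdet : A.det ≠ 0) (V : Submodule (ZMod p) (Fin d → ZMod p)) :
    LinearMap.BilinForm.orthogonal (Matrix.toBilin' A)
      (LinearMap.BilinForm.orthogonal (Matrix.toBilin' A) V) = V := by
  have hnd := LinearMap.BilinForm.nondegenerate_toBilin'_of_det_ne_zero' A hdet
  have hsymm : ∀ x y, Matrix.toBilin' A x y = Matrix.toBilin' A y x := by
    intro x y
    rw [Matrix.toBilin'_apply', Matrix.toBilin'_apply', Matrix.dotProduct_mulVec,
      ← Matrix.mulVec_transpose, hA.eq, dotProduct_comm]
  apply LinearMap.BilinForm.orthogonal_orthogonal hnd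
  intro x y h
  rw [hsymm, h]

lemma lin_not_mem {d : ℕ} (A : Matrix (Fin d) (Fin d) (ZMod p)) (hA : A.IsSymm)
    (hdet : A.det ≠ 0) (V : Submodule (ZMod p) (Fin d → ZMod p)) {h : Fin d → ZMod p}
    (hh : h ∉ V) : linPoly p d A h ∉ JM p d A (V : Set (Fin d → ZMod p)) := by
  intro hmem
  apply hh
  rw [← orth A hA hdet V]
  intro n hn
  let θ : MvPolynomial (Fin d) (ZMod p) →ₐ[ZMod p] DualNumber (ZMod p) :=
    MvPolynomial.aeval (fun i => n i • DualNumber.eps)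
  have hsymm : ∀ x y, Matrix.toBilin' A x y = Matrix.toBilin' A y x := by
    intro x y
    rw [Matrix.toBilin'_apply', Matrix.toBilin'_apply', Matrix.dotProduct_mulVec,
      ← Matrix.mulVec_transpose, hA.eq, dotProduct_comm]
  have hlin : ∀ g, θ (linPoly p d A g) = Matrix.toBilin' A n g • DualNumber.eps := by
    intro g
    rw [hsymm, linPoly_eq, Matrix.toBilin'_apply', Matrix.dotProduct_mulVec]
    simp only [lf, θ, map_sum, map_mul, MvPolynomial.aeval_X, dotProduct,
      MvPolynomial.aeval_C, Finset.sum_smul]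
    refine Finset.sum_congr rfl fun i _ => ?_
    rw [← Algebra.smul_def, smul_smul]
  have hker : JM p d A (V : Set (Fin d → ZMod p)) ≤ RingHom.ker θ := by
    rw [JM, Ideal.span_le]
    rintro x (rfl | ⟨g, hg, rfl⟩)
    · rw [SetLike.mem_coe, RingHom.mem_ker]
      simp [quadPoly, θ]
    · rw [SetLike.mem_coe, RingHom.mem_ker, hlin, hsymm, hn g hg, zero_smul]
  have := hker hmem
  rw [RingHom.mem_ker, hlin] at this
  have h2 := congrArg TrivSqZeroExt.snd this
  simpa using h2

lemma prime_JM {d : ℕ} (hp : p ≠ 2) (hd : 9 ≤ d) (A : Matrix (Fin d) (Fin d) (ZMod p))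
    (hA : A.IsSymm) (hdet : A.det ≠ 0) (V : Submodule (ZMod p) (Fin d → ZMod p))
    (hV : Module.finrank (ZMod p) V ≤ 2) : (JM p d A (V : Set (Fin d → ZMod p))).IsPrime := by
  have hnd := LinearMap.BilinForm.nondegenerate_toBilin'_of_det_ne_zero' A hdet
  set W := LinearMap.BilinForm.orthogonal (Matrix.toBilin' A) V with hWdef
  obtain ⟨n, hn⟩ : ∃ n, Module.finrank (ZMod p) W = n := ⟨_, rfl⟩
  have hfW := LinearMap.BilinForm.finrank_orthogonal hnd V
  rw [← hWdef, hn, Module.finrank_fin_fun] at hfW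
  let e : (Fin n → ZMod p) ≃ₗ[ZMod p] W := LinearEquiv.ofFinrankEq _ _ (by simp [hn])
  let T : (Fin n → ZMod p) →ₗ[ZMod p] (Fin d → ZMod p) := W.subtype ∘ₗ e.toLinearMap
  have hT : Function.Injective T := W.injective_subtype.comp e.injective
  obtain ⟨L, hL⟩ := T.exists_leftInverse_of_injective (LinearMap.ker_eq_bot.2 hT)
  let N := LinearMap.toMatrix' T
  let L' := LinearMap.toMatrix' L
  have hLN : L' * N = 1 := by
    rw [← LinearMap.toMatrix'_comp, hL, LinearMap.toMatrix'_id]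
  have hN : Matrix.mulVecLin N = T := by
    rw [← Matrix.toLin'_apply', Matrix.toLin'_toMatrix']
  have hirr := irred hp A hA hdet N (by rw [hN]; exact hT) (by omega)
  have hσ : ∀ g, sb N (sb L' g) = g := by
    intro g
    have : (sb N).comp (sb L') = AlgHom.id _ _ := by
      apply MvPolynomial.algHom_ext
      intro i
      have : sb L' (MvPolynomial.X i) = lf (L' i) := by simp [sb]
      rw [AlgHom.comp_apply, this, sb_lf, AlgHom.id_apply, ← lf_one i, ← hLN]
      rfl
    exact DFunLike.congr_fun this g
  set J := JM p d A (V : Set (Fin d → ZMod p)) with hJ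
  have hlin : ∀ a : Fin d → ZMod p, (∀ w ∈ W, a ⬝ᵥ w = 0) → lf a ∈ J := by
    intro a ha
    have hdu : IsUnit A.det := isUnit_iff_ne_zero.2 hdet
    have hb : Matrix.vecMul (Matrix.vecMul a A⁻¹) A = a := by
      rw [Matrix.vecMul_vecMul, Matrix.nonsing_inv_mul _ hdu, Matrix.vecMul_one]
    rw [← hb, ← linPoly_eq]
    apply lin_mem
    rw [SetLike.mem_coe, ← orth A hA hdet V]
    intro w hw
    have := ha w hw
    rw [Matrix.toBilin'_apply', ← Matrix.mulVec_transpose] at *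
    rw [← hb, ← Matrix.mulVec_transpose, hA.eq] at this
    rwa [dotProduct_comm] at this
  have hτ : ∀ f, f - sb L' (sb N f) ∈ J := by
    intro f
    have : (Ideal.Quotient.mkₐ (ZMod p) J).comp ((sb L').comp (sb N)) =
        Ideal.Quotient.mkₐ (ZMod p) J := by
      apply MvPolynomial.algHom_ext
      intro i
      have h1 : sb N (MvPolynomial.X i) = lf (N i) := by simp [sb]
      rw [AlgHom.comp_apply, AlgHom.comp_apply, h1, sb_lf]
      simp only [Ideal.Quotient.mkₐ_eq_mk]
      rw [eq_comm, Ideal.Quotient.eq, ← lf_one i, ← lf_sub]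
      apply hlin
      intro w hw
      obtain ⟨t, rfl⟩ : ∃ t, T t = w := ⟨e.symm ⟨w, hw⟩, by simp [T]⟩
      have h2 : Matrix.vecMul (N i) L' = (N * L') i := rfl
      rw [h2, sub_dotProduct, sub_eq_zero]
      change (Matrix.mulVec 1 (T t)) i = (Matrix.mulVec (N * L') (T t)) i
      rw [← hN, Matrix.mulVecLin_apply, Matrix.mulVec_mulVec, Matrix.mulVec_mulVec,
        Matrix.mul_assoc, hLN]
      simp
    have := DFunLike.congr_fun this f
    simp only [AlgHom.comp_apply, Ideal.Quotient.mkₐ_eq_mk] at this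
    exact (Ideal.Quotient.eq).1 this.symm
  have hcomap : J = Ideal.comap (sb N) (Ideal.span {sb N (quadPoly p d A)}) := by
    apply le_antisymm
    · rw [hJ, JM, Ideal.span_le]
      rintro x (rfl | ⟨g, hg, rfl⟩)
      · exact Ideal.subset_span rfl
      · have : sb N (linPoly p d A g) = 0 := by
          rw [linPoly_eq, sb_lf]
          have : Matrix.vecMul (Matrix.vecMul g A) N = 0 := by
            ext j
            have h3 := (e (Pi.single j 1)).2 g hg
            have h4 : ((e (Pi.single j 1) : W) : Fin d → ZMod p) = T (Pi.single j 1) := rfl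
            rw [h4, ← hN, Matrix.toBilin'_apply', Matrix.dotProduct_mulVec] at h3
            simp only [Matrix.mulVecLin_apply] at h3
            rw [Matrix.dotProduct_mulVec] at h3
            simpa using h3
          rw [this]; simp [lf]
        rw [SetLike.mem_coe, Ideal.mem_comap]
        rw [this]; exact Ideal.zero_mem _
    · intro f hf
      obtain ⟨g, hg⟩ := Ideal.mem_span_singleton'.1 (Ideal.mem_comap.1 hf)
      have h1 := hτ f
      have h2 := hτ (sb L' g * quadPoly p d A)
      rw [map_mul (sb N), hσ] at h2
      have hg' : g * sb N (quadPoly p d A) = sb N f := hg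
      rw [hg'] at h2
      have h3 : sb L' g * quadPoly p d A ∈ J :=
        Ideal.mul_mem_left _ _ (Ideal.subset_span (Or.inl rfl))
      have : f = (f - sb L' (sb N f)) - (sb L' g * quadPoly p d A - sb L' (sb N f))
        + sb L' g * quadPoly p d A := by ring
      rw [this]
      exact J.add_mem (J.sub_mem h1 h2) h3
  rw [hcomap]
  have : (Ideal.span {sb N (quadPoly p d A)}).IsPrime :=
    (Ideal.span_singleton_prime hirr.ne_zero).2 hirr.prime
  exact Ideal.comap_isPrime _ _

end part1

section part2
set_option linter.unusedSectionVars false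
variable {p : ℕ} [Fact p.Prime] {d : ℕ}

lemma JM_mono (A : Matrix (Fin d) (Fin d) (ZMod p)) {V W : Set (Fin d → ZMod p)}
    (h : V ⊆ W) : JM p d A V ≤ JM p d A W :=
  Ideal.span_mono (Set.union_subset_union_right _ (Set.image_mono h))

lemma JM_span_mono (A : Matrix (Fin d) (Fin d) (ZMod p)) {S T : Set (Fin d → ZMod p)}
    (h : S ⊆ Submodule.span (ZMod p) T) {f} (hf : f ∈ JM p d A (Submodule.span (ZMod p) S)) :
    f ∈ JM p d A (Submodule.span (ZMod p) T) :=
  JM_mono A (Submodule.span_le.2 h) hf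

lemma hc_mem (A : Matrix (Fin d) (Fin d) (ZMod p)) (V : Set (Fin d → ZMod p)) (s : ℕ)
    {f} (hf : f ∈ JM p d A V) : MvPolynomial.homogeneousComponent s f ∈ JM p d A V := by
  let _ := MvPolynomial.gradedAlgebra (σ := Fin d) (R := ZMod p)
  refine MvPolynomial.homogeneousComponent_mem_of_mem ?_ hf s
  apply Ideal.homogeneous_span
  rintro x (rfl | ⟨g, hg, rfl⟩)
  · exact ⟨2, quad_hom A⟩
  · exact ⟨1, by rw [linPoly_eq]; exact lf_hom _⟩

lemma hc_mul (s n : ℕ) (hn : s < n) (g P : MvPolynomial (Fin d) (ZMod p))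
    (hP : P.IsHomogeneous n) : MvPolynomial.homogeneousComponent s (g * P) = 0 := by
  let _ := MvPolynomial.gradedAlgebra (σ := Fin d) (R := ZMod p)
  have := DirectSum.coe_decompose_mul_of_right_mem_of_not_le
    (𝒜 := MvPolynomial.homogeneousSubmodule (Fin d) (ZMod p)) (a := g) (n := s) (i := n)
    (b := P) hP (by omega)
  rw [← this]
  exact (MvPolynomial.decomposition.decompose'_apply (g * P) s).symm

lemma split_mem (A : Matrix (Fin d) (Fin d) (ZMod p)) (u h : Fin d → ZMod p) {g}
    (hg : g ∈ JM p d A (Submodule.span (ZMod p) {u, h})) :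
    ∃ l, g - l * linPoly p d A h ∈ JM p d A (Submodule.span (ZMod p) {u}) := by
  have hle : JM p d A (Submodule.span (ZMod p) {u, h}) ≤
      JM p d A (Submodule.span (ZMod p) {u}) ⊔ Ideal.span {linPoly p d A h} := by
    rw [JM, Ideal.span_le]
    rintro x (rfl | ⟨v, hv, rfl⟩)
    · exact Ideal.mem_sup_left (Ideal.subset_span (Or.inl rfl))
    · obtain ⟨a, b, rfl⟩ := Submodule.mem_span_pair.1 hv
      have hadd : linPoly p d A (a • u + b • h) =
          linPoly p d A (a • u) + linPoly p d A (b • h) := by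
        simp only [linPoly_eq, Matrix.add_vecMul, lf_add]
      rw [hadd]
      refine Ideal.add_mem _ (Ideal.mem_sup_left (lin_mem _ _ ?_)) (Ideal.mem_sup_right ?_)
      · exact Submodule.smul_mem _ _ (Submodule.mem_span_singleton_self u)
      · rw [Ideal.mem_span_singleton']
        refine ⟨MvPolynomial.C b, ?_⟩
        simp [linPoly_eq, lf, Matrix.smul_vecMul, Finset.mul_sum, mul_assoc]
  obtain ⟨j, hj, l, hl, rfl⟩ := Submodule.mem_sup.1 (hle hg)
  obtain ⟨l, rfl⟩ := Ideal.mem_span_singleton'.1 hl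
  exact ⟨l, by simpa using hj⟩

lemma keyK {ι : Type*} [DecidableEq ι] (hp : p ≠ 2) (hd : 9 ≤ d)
    (A : Matrix (Fin d) (Fin d) (ZMod p))
    (hA : A.IsSymm) (hdet : A.det ≠ 0) (u : Fin d → ZMod p) (h : ι → Fin d → ZMod p)
    (f : MvPolynomial (Fin d) (ZMod p)) (G : Finset ι)
    (hind : ∀ i ∈ G, ∀ j ∈ G, i ≠ j → h i ∉ Submodule.span (ZMod p) {u, h j})
    (hf : ∀ i ∈ G, f ∈ JM p d A (Submodule.span (ZMod p) {u, h i})) :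
    ∃ g, f - g * ∏ i ∈ G, linPoly p d A (h i) ∈ JM p d A (Submodule.span (ZMod p) {u}) := by
  induction G using Finset.induction_on with
  | empty => exact ⟨f, by simp⟩
  | insert a G ha ih =>
    obtain ⟨g, hg⟩ := ih (fun i hi j hj => hind i (Finset.mem_insert_of_mem hi) j
      (Finset.mem_insert_of_mem hj)) (fun i hi => hf i (Finset.mem_insert_of_mem hi))
    have hpr : (JM p d A (Submodule.span (ZMod p) {u, h a})).IsPrime := by
      apply prime_JM hp hd A hA hdet
      have := finrank_span_finset_le_card (R := ZMod p) ({u, h a} : Finset (Fin d → ZMod p))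
      simp only [Finset.coe_insert, Finset.coe_singleton] at this
      exact this.trans Finset.card_le_two
    have h1 : f - g * ∏ i ∈ G, linPoly p d A (h i) ∈
        JM p d A (Submodule.span (ZMod p) {u, h a}) :=
      JM_span_mono A (fun x hx => Submodule.subset_span (Or.inl hx)) hg
    have h2 := hf a (Finset.mem_insert_self _ _)
    have h3 : g * ∏ i ∈ G, linPoly p d A (h i) ∈
        JM p d A (Submodule.span (ZMod p) {u, h a}) := by
      have := Ideal.sub_mem _ h2 h1
      simpa using this
    have h4 : g ∈ JM p d A (Submodule.span (ZMod p) {u, h a}) := by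
      rcases hpr.mem_or_mem h3 with h4 | h4
      · exact h4
      · obtain ⟨i, hi, h5⟩ := (hpr.prod_mem_iff).1 h4
        refine absurd h5 (lin_not_mem A hA hdet _ ?_)
        exact hind i (Finset.mem_insert_of_mem hi) a (Finset.mem_insert_self _ _)
          (fun hia => ha (hia ▸ hi))
    obtain ⟨l, hl⟩ := split_mem A u (h a) h4
    refine ⟨l, ?_⟩
    rw [Finset.prod_insert ha]
    have h6 := Ideal.add_mem _ hg (Ideal.mul_mem_right (∏ i ∈ G, linPoly p d A (h i)) _ hl)
    convert h6 using 1
    ring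

lemma keyK_hom {ι : Type*} [DecidableEq ι] (hp : p ≠ 2) (hd : 9 ≤ d)
    (A : Matrix (Fin d) (Fin d) (ZMod p))
    (hA : A.IsSymm) (hdet : A.det ≠ 0) (u : Fin d → ZMod p) (h : ι → Fin d → ZMod p)
    (f : MvPolynomial (Fin d) (ZMod p)) (G : Finset ι)
    (hind : ∀ i ∈ G, ∀ j ∈ G, i ≠ j → h i ∉ Submodule.span (ZMod p) {u, h j})
    (hf : ∀ i ∈ G, f ∈ JM p d A (Submodule.span (ZMod p) {u, h i}))
    (s : ℕ) (hs : s < G.card) (hfs : f.IsHomogeneous s) :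
    f ∈ JM p d A (Submodule.span (ZMod p) {u}) := by
  obtain ⟨g, hg⟩ := keyK hp hd A hA hdet u h f G hind hf
  have hP : (∏ i ∈ G, linPoly p d A (h i)).IsHomogeneous (∑ i ∈ G, 1) :=
    MvPolynomial.IsHomogeneous.prod _ _ _ (fun i _ => by rw [linPoly_eq]; exact lf_hom _)
  have := hc_mem A _ s hg
  rw [map_sub, hc_mul s _ (by simpa using hs) g _ hP, sub_zero,
    MvPolynomial.homogeneousComponent_eq_self hfs] at this
  exact this

lemma crt0 {ι : Type*} [DecidableEq ι] (hp : p ≠ 2) (hd : 9 ≤ d)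
    (A : Matrix (Fin d) (Fin d) (ZMod p))
    (hA : A.IsSymm) (hdet : A.det ≠ 0) (h : ι → Fin d → ZMod p)
    (f : ι → MvPolynomial (Fin d) (ZMod p)) (G : Finset ι)
    (hind : ∀ i ∈ G, ∀ j ∈ G, ∀ k ∈ G, i ≠ j → i ≠ k → j ≠ k →
      h i ∉ Submodule.span (ZMod p) {h k, h j})
    (hf : ∀ i ∈ G, ∀ j ∈ G, i ≠ j →
      f i - f j ∈ JM p d A (Submodule.span (ZMod p) {h i, h j})) :
    ∃ φ, ∀ i ∈ G, φ - f i ∈ JM p d A (Submodule.span (ZMod p) {h i}) := by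
  induction G using Finset.induction_on with
  | empty => exact ⟨0, by simp⟩
  | insert a G ha ih =>
    have mi : ∀ {i}, i ∈ G → i ∈ insert a G := fun hi => Finset.mem_insert_of_mem hi
    have ma : a ∈ insert a G := Finset.mem_insert_self _ _
    have ne : ∀ {i}, i ∈ G → i ≠ a := fun hi hia => ha (hia ▸ hi)
    obtain ⟨φ, hφ⟩ := ih
      (fun i hi j hj k hk => hind i (mi hi) j (mi hj) k (mi hk))
      (fun i hi j hj => hf i (mi hi) j (mi hj))
    obtain ⟨g, hg⟩ := keyK hp hd A hA hdet (h a) h (f a - φ) G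
      (fun i hi j hj hij => hind i (mi hi) j (mi hj) a ma hij (ne hi) (ne hj))
      (by
        intro i hi
        have h1 := hf a ma i (mi hi) (ne hi).symm
        have h2 : φ - f i ∈ JM p d A (Submodule.span (ZMod p) {h a, h i}) :=
          JM_span_mono A (fun x hx => Submodule.subset_span (Or.inr hx)) (hφ i hi)
        have := Ideal.sub_mem _ h1 h2
        convert this using 1
        ring)
    refine ⟨φ + g * ∏ i ∈ G, linPoly p d A (h i), ?_⟩
    intro i hi
    rcases Finset.mem_insert.1 hi with rfl | hi
    · have := (JM p d A (Submodule.span (ZMod p) {h i})).neg_mem hg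
      convert this using 1
      ring
    · have h1 : ∏ i ∈ G, linPoly p d A (h i) ∈ JM p d A (Submodule.span (ZMod p) {h i}) := by
        rw [← Finset.mul_prod_erase _ _ hi]
        exact Ideal.mul_mem_right _ _ (lin_mem _ _ (Submodule.mem_span_singleton_self _))
      have := Ideal.add_mem _ (hφ i hi) (Ideal.mul_mem_left _ g h1)
      convert this using 1
      ring

lemma crt {ι : Type*} [DecidableEq ι] (hp : p ≠ 2) (hd : 9 ≤ d)
    (A : Matrix (Fin d) (Fin d) (ZMod p))
    (hA : A.IsSymm) (hdet : A.det ≠ 0) (h : ι → Fin d → ZMod p)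
    (f : ι → MvPolynomial (Fin d) (ZMod p)) (G : Finset ι)
    (hind : ∀ i ∈ G, ∀ j ∈ G, ∀ k ∈ G, i ≠ j → i ≠ k → j ≠ k →
      h i ∉ Submodule.span (ZMod p) {h k, h j})
    (hf : ∀ i ∈ G, ∀ j ∈ G, i ≠ j →
      f i - f j ∈ JM p d A (Submodule.span (ZMod p) {h i, h j}))
    (s : ℕ) (hs : ∀ i ∈ G, (f i).IsHomogeneous s) :
    ∃ φ : MvPolynomial (Fin d) (ZMod p), φ.IsHomogeneous s ∧
      ∀ i ∈ G, φ - f i ∈ JM p d A (Submodule.span (ZMod p) {h i}) := by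
  obtain ⟨φ, hφ⟩ := crt0 hp hd A hA hdet h f G hind hf
  refine ⟨MvPolynomial.homogeneousComponent s φ,
    MvPolynomial.homogeneousComponent_isHomogeneous _ _, fun i hi => ?_⟩
  have := hc_mem A _ s (hφ i hi)
  rwa [map_sub, MvPolynomial.homogeneousComponent_eq_self (hs i hi)] at this

end part2

section part3
set_option linter.unusedSectionVars false

lemma exch {K E ι : Type*} [Field K] [AddCommGroup E] [Module K E]
    {w : ι → E} (hw : LinearIndependent K w) (P : Set ι) (x : E)
    (hx : x ∉ Submodule.span K (w '' P)) (hP : ∃ i, i ∉ P) :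
    ∃ i, i ∉ P ∧ x ∉ Submodule.span K (w '' {i}ᶜ) := by
  by_contra! hcon
  obtain ⟨i1, hi1⟩ := hP
  obtain ⟨c, -, hc⟩ := (Finsupp.mem_span_image_iff_linearCombination K).1 (hcon i1 hi1)
  apply hx
  refine (Finsupp.mem_span_image_iff_linearCombination K).2 ⟨c, ?_, hc⟩
  intro i hi
  by_contra hiP
  obtain ⟨c', hc's, hc'⟩ := (Finsupp.mem_span_image_iff_linearCombination K).1 (hcon i hiP)
  have : c' = c := hw (hc'.trans hc.symm)
  subst this
  exact (hc's hi) rfl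

lemma upd {K E ι : Type*} [Field K] [AddCommGroup E] [Module K E] [DecidableEq ι]
    {w : ι → E} (hw : LinearIndependent K w) (i : ι) (x : E)
    (hx : x ∉ Submodule.span K (w '' {i}ᶜ)) :
    LinearIndependent K (Function.update w i x) := by
  have heq : Set.EqOn w (Function.update w i x) {i}ᶜ := by
    intro j hj
    rw [Function.update_of_ne hj]
  rw [← linearIndepOn_univ_iff, show (Set.univ : Set ι) = insert i {i}ᶜ by ext j; simp [em],
    linearIndepOn_insert (by simp)]
  refine ⟨((linearIndepOn_univ_iff.2 hw).mono (Set.subset_univ _)).congr heq, ?_⟩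
  rw [← heq.image_eq, Function.update_self]
  exact hx

lemma li_congr {K E ι : Type*} [Field K] [AddCommGroup E] [Module K E]
    {f g : ι → E} (hg : LinearIndependent K g) (h : ∀ l, f l = g l) :
    LinearIndependent K f := by
  rw [show f = g from funext h]; exact hg

variable {p : ℕ} [Fact p.Prime] {d : ℕ}

lemma vsi {m : ℕ} (h : Fin m → (Fin d → ZMod p)) (U : Submodule (ZMod p) (Fin d → ZMod p)) :
    VecSubIndep p d h U ⊥ ↔ LinearIndependent (ZMod p) (fun i => U.mkQ (h i)) := by
  rw [Fintype.linearIndependent_iff]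
  constructor
  · intro H g hg
    have h1 : U.mkQ (∑ i, g i • h i) = 0 := by simpa using hg
    rw [Submodule.mkQ_apply, Submodule.Quotient.mk_eq_zero] at h1
    exact (H g (-(∑ i, g i • h i)) (U.neg_mem h1) 0 (Submodule.zero_mem _) (by simp)).1
  · intro H c u hu w hw h0
    rw [Submodule.mem_bot] at hw
    subst hw
    have hc := H c (by
      have := congrArg U.mkQ h0
      have hu' : U.mkQ u = 0 := by
        rwa [Submodule.mkQ_apply, Submodule.Quotient.mk_eq_zero]
      rw [map_add, map_add, hu', map_zero, add_zero, add_zero, map_sum] at this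
      simpa only [map_smul] using this)
    refine ⟨hc, ?_, rfl⟩
    simpa [hc] using h0

lemma exists_z {δ : ℝ} (hp : 1 ≤ δ * p) (H : Finset (Fin d → ZMod p))
    (hd : 1 ≤ d)
    (hH : δ * (p : ℝ) ^ d < (H.card : ℝ)) (U : Submodule (ZMod p) (Fin d → ZMod p))
    (m : ℕ) (hm : m + Module.finrank (ZMod p) U ≤ d) :
    ∃ z : Fin m → (Fin d → ZMod p), (∀ i, z i ∈ H) ∧
      LinearIndependent (ZMod p) (fun i => U.mkQ (z i)) := by
  have hpp : 0 < p := (Fact.out : p.Prime).pos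
  have hspan : Submodule.span (ZMod p) (H : Set (Fin d → ZMod p)) = ⊤ := by
    by_contra hne
    have hlt := Submodule.finrank_lt hne
    rw [Module.finrank_fin_fun] at hlt
    have hcard : Nat.card (Submodule.span (ZMod p) (H : Set (Fin d → ZMod p))) =
        p ^ Module.finrank (ZMod p) (Submodule.span (ZMod p) (H : Set (Fin d → ZMod p))) := by
      rw [Module.natCard_eq_pow_finrank (K := ZMod p), Nat.card_zmod]
    have h1 : H.card ≤ Nat.card (Submodule.span (ZMod p) (H : Set (Fin d → ZMod p))) := by
      have := Nat.card_mono (Set.toFinite _)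
        (Submodule.subset_span (R := ZMod p) (s := (H : Set (Fin d → ZMod p))))
      simpa using this
    have h2 : H.card ≤ p ^ (d - 1) := by
      rw [hcard] at h1
      exact h1.trans (Nat.pow_le_pow_right hpp (by omega))
    have h3 : (H.card : ℝ) ≤ (p : ℝ) ^ (d - 1) := by exact_mod_cast h2
    have h4 : (p : ℝ) ^ d = p * (p : ℝ) ^ (d - 1) := by
      rw [← pow_succ']; congr 1; omega
    rw [h4] at hH
    have h5 : (0 : ℝ) < (p : ℝ) ^ (d - 1) := by positivity
    nlinarith
  obtain ⟨f, hf, -, hfi⟩ := Submodule.exists_fun_fin_finrank_span_eq (ZMod p)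
    (U.mkQ '' (H : Set (Fin d → ZMod p)))
  have hfr : Module.finrank (ZMod p) (Submodule.span (ZMod p)
      (U.mkQ '' (H : Set (Fin d → ZMod p)))) = d - Module.finrank (ZMod p) U := by
    rw [← Submodule.map_span, hspan, Submodule.map_top, Submodule.range_mkQ, finrank_top]
    have := Submodule.finrank_quotient_add_finrank U
    rw [Module.finrank_fin_fun] at this
    omega
  choose z hz hzf using hf
  have hle : m ≤ Module.finrank (ZMod p) (Submodule.span (ZMod p)
      (U.mkQ '' (H : Set (Fin d → ZMod p)))) := by omega
  refine ⟨fun i => z (Fin.castLE hle i), fun i => hz _, ?_⟩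
  have := hfi.comp (Fin.castLE hle) (Fin.castLE_injective hle)
  have heq : (fun i => U.mkQ (z (Fin.castLE hle i))) = f ∘ Fin.castLE hle := by
    funext i
    exact hzf _
  rw [heq]
  exact this

end part3

section part4
set_option linter.unusedSectionVars false

lemma li_cons {K E ι : Type*} [Field K] [AddCommGroup E] [Module K E]
    {w : ι → E} (hw : LinearIndependent K w) (G : Set ι) (x : E)
    (hx : x ∉ Submodule.span K (w '' G)) {n : ℕ} (f : Fin n → ι) (hf : Function.Injective f)
    (hG : ∀ i, f i ∈ G) :
    LinearIndependent K (Fin.cons x (w ∘ f) : Fin (n + 1) → E) := by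
  rw [linearIndependent_finCons]
  refine ⟨hw.comp f hf, fun h => hx ?_⟩
  refine Submodule.span_mono ?_ h
  rintro _ ⟨i, rfl⟩
  exact ⟨f i, hG i, rfl⟩

lemma ns1 {K V E : Type*} [Field K] [AddCommGroup V] [Module K V] [AddCommGroup E] [Module K E]
    (q : V →ₗ[K] E) (x a b c : V) (h : LinearIndependent K ![q x, q a, q b, q c]) :
    x - a ∉ Submodule.span K {x - c, x - b} := by
  intro hm
  obtain ⟨s, t, hst⟩ := Submodule.mem_span_pair.1 hm
  rw [Fintype.linearIndependent_iff] at h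
  have := h ![s + t - 1, 1, -t, -s] (by
    have h1 := congrArg q hst
    simp only [map_add, map_smul, map_sub] at h1
    rw [← sub_eq_zero] at h1
    simp only [Fin.sum_univ_four, Matrix.cons_val]
    rw [← h1]
    module) 1
  simp at this

lemma ns2 {K V E : Type*} [Field K] [AddCommGroup V] [Module K V] [AddCommGroup E] [Module K E]
    (q : V →ₗ[K] E) (x y a b : V) (h : LinearIndependent K ![q x, q y, q a, q b]) :
    y - a ∉ Submodule.span K {x - y, y - b} := by
  intro hm
  obtain ⟨s, t, hst⟩ := Submodule.mem_span_pair.1 hm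
  rw [Fintype.linearIndependent_iff] at h
  have := h ![s, t - s - 1, 1, -t] (by
    have h1 := congrArg q hst
    simp only [map_add, map_smul, map_sub] at h1
    rw [← sub_eq_zero] at h1
    simp only [Fin.sum_univ_four, Matrix.cons_val]
    rw [← h1]
    module) 2
  simp at this

variable {p : ℕ} [Fact p.Prime] {d : ℕ}

lemma step {s m : ℕ} (hp : p ≠ 2) (hd : 9 ≤ d)
    (A : Matrix (Fin d) (Fin d) (ZMod p))
    (hA : A.IsSymm) (hdet : A.det ≠ 0)
    (H : Finset (Fin d → ZMod p)) (U : Submodule (ZMod p) (Fin d → ZMod p))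
    (C : (Fin d → ZMod p) → (Fin d → ZMod p) → MvPolynomial (Fin d) (ZMod p))
    (hC1 : ∀ x ∈ H, ∀ y ∈ H, VecSubIndep p d ![x, y] U ⊥ → (C x y).IsHomogeneous s)
    (hC2 : ∀ x ∈ H, ∀ y ∈ H, ∀ z ∈ H, VecSubIndep p d ![x, y, z] U ⊥ →
        C x y + C y z - C x z ∈
          JM p d A (Submodule.span (ZMod p) {x - y, y - z} : Set (Fin d → ZMod p)))
    (z : Fin m → (Fin d → ZMod p)) (hzH : ∀ i, z i ∈ H)
    (hz : LinearIndependent (ZMod p) (fun i => U.mkQ (z i)))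
    (G : Finset (Fin m)) (ψ : Fin m → MvPolynomial (Fin d) (ZMod p))
    (hψ : ∀ i, (ψ i).IsHomogeneous s)
    (hψ2 : ∀ i ∈ G, ∀ j ∈ G, j < i → ψ i - ψ j - C (z i) (z j) ∈
      JM p d A (Submodule.span (ZMod p) {z i - z j} : Set (Fin d → ZMod p)))
    (x : Fin d → ZMod p) (hx : x ∈ H)
    (hxG : U.mkQ x ∉ Submodule.span (ZMod p) ((fun i => U.mkQ (z i)) '' (G : Set (Fin m)))) :
    ∃ φ : MvPolynomial (Fin d) (ZMod p), φ.IsHomogeneous s ∧ ∀ i ∈ G,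
      φ - (C x (z i) + ψ i) ∈
        JM p d A (Submodule.span (ZMod p) {x - z i} : Set (Fin d → ZMod p)) := by
  have hlt : ∀ i ∈ G, ∀ j ∈ G, j < i → (C x (z i) + ψ i) - (C x (z j) + ψ j) ∈
      JM p d A (Submodule.span (ZMod p) {x - z i, x - z j} : Set (Fin d → ZMod p)) := by
    intro i hi j hj hij
    have hli := li_cons hz G (U.mkQ x) hxG ![i, j]
      (by rw [List.nodup_ofFn.symm]; simp [hij.ne'])
      (by intro l; fin_cases l <;> assumption)
    have h1 := hC2 x hx (z i) (hzH i) (z j) (hzH j) (by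
      rw [vsi]
      exact li_congr hli (fun l => by fin_cases l <;> rfl))
    have h2 := hψ2 i hi j hj hij
    have hm1 : x - z i ∈ Submodule.span (ZMod p) {x - z i, x - z j} :=
      Submodule.subset_span (Or.inl rfl)
    have hm2 : z i - z j ∈ Submodule.span (ZMod p) {x - z i, x - z j} := by
      have : z i - z j = (x - z j) - (x - z i) := by abel
      rw [this]
      exact Submodule.sub_mem _ (Submodule.subset_span (Or.inr rfl)) hm1
    have h3 := JM_span_mono A (T := {x - z i, x - z j}) (by
      rintro v (rfl | rfl)
      · exact hm1
      · exact hm2) h1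
    have h4 := JM_span_mono A (T := {x - z i, x - z j}) (by
      rintro v rfl
      exact hm2) h2
    have := Ideal.add_mem _ h3 h4
    convert this using 1
    ring
  refine crt hp hd A hA hdet (fun i => x - z i) (fun i => C x (z i) + ψ i) G ?_ ?_ s ?_
  · intro i hi j hj k hk hij hik hjk
    have hli := li_cons hz G (U.mkQ x) hxG ![i, j, k]
      (by rw [List.nodup_ofFn.symm]; simp [hij, hik, hjk])
      (by intro l; fin_cases l <;> assumption)
    apply ns1 U.mkQ
    convert hli using 1
    funext l; fin_cases l <;> rfl
  · intro i hi j hj hij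
    rcases lt_or_gt_of_ne hij with h | h
    · have := Ideal.neg_mem_iff _ |>.2 (hlt j hj i hi h)
      rw [neg_sub] at this
      rwa [Set.pair_comm] at this
    · exact hlt i hi j hj h
  · intro i hi
    have hli := li_cons hz G (U.mkQ x) hxG ![i]
      (by rw [List.nodup_ofFn.symm]; simp)
      (by intro l; fin_cases l; assumption)
    refine (hC1 x hx _ (hzH i) ?_).add (hψ i)
    rw [vsi]
    exact li_congr hli (fun l => by fin_cases l <;> rfl)

lemma exists_psi {s m : ℕ} (hp : p ≠ 2) (hd : 9 ≤ d)
    (A : Matrix (Fin d) (Fin d) (ZMod p))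
    (hA : A.IsSymm) (hdet : A.det ≠ 0)
    (H : Finset (Fin d → ZMod p)) (U : Submodule (ZMod p) (Fin d → ZMod p))
    (C : (Fin d → ZMod p) → (Fin d → ZMod p) → MvPolynomial (Fin d) (ZMod p))
    (hC1 : ∀ x ∈ H, ∀ y ∈ H, VecSubIndep p d ![x, y] U ⊥ → (C x y).IsHomogeneous s)
    (hC2 : ∀ x ∈ H, ∀ y ∈ H, ∀ z ∈ H, VecSubIndep p d ![x, y, z] U ⊥ →
        C x y + C y z - C x z ∈
          JM p d A (Submodule.span (ZMod p) {x - y, y - z} : Set (Fin d → ZMod p)))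
    (z : Fin m → (Fin d → ZMod p)) (hzH : ∀ i, z i ∈ H)
    (hz : LinearIndependent (ZMod p) (fun i => U.mkQ (z i))) (k : ℕ) (hk : k ≤ m) :
    ∃ ψ : Fin m → MvPolynomial (Fin d) (ZMod p), (∀ i, (ψ i).IsHomogeneous s) ∧
      ∀ i j : Fin m, i.1 < k → j < i → ψ i - ψ j - C (z i) (z j) ∈
      JM p d A (Submodule.span (ZMod p) {z i - z j} : Set (Fin d → ZMod p)) := by
  induction k with
  | zero => exact ⟨0, fun i => MvPolynomial.isHomogeneous_zero _ _ _, by simp⟩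
  | succ k ih =>
    obtain ⟨ψ, h1, h2⟩ := ih (by omega)
    let a : Fin m := ⟨k, by omega⟩
    obtain ⟨φ, hφ1, hφ2⟩ := step hp hd A hA hdet H U C hC1 hC2 z hzH hz
      (Finset.univ.filter (fun i => i < a)) ψ h1
      (fun i hi j hj hji => h2 i j (by simpa [a, Fin.lt_def] using hi) hji) (z a) (hzH a)
      (hz.notMem_span_image (by simp))
    refine ⟨Function.update ψ a φ, ?_, ?_⟩
    · intro i
      by_cases hi : i = a
      · subst hi; simpa using hφ1
      · rw [Function.update_of_ne hi]; exact h1 i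
    · intro i j hi hji
      have hja : j ≠ a := by
        intro h; subst h
        simp only [a, Fin.lt_def] at hji
        omega
      rw [Function.update_of_ne hja]
      by_cases hia : i = a
      · subst hia
        rw [Function.update_self]
        have := hφ2 j (by simpa using hji)
        convert this using 1
        ring
      · rw [Function.update_of_ne hia]
        refine h2 i j ?_ hji
        have : i.1 ≠ k := fun h => hia (Fin.ext h)
        omega

end part4

end S13

/-- **Solution to the cocycle equation.**  If `C(x,y) + C(y,z) ≡ C(x,z) mod J^M_{x-y,y-z}`
on a dense set, then `C(x,y) ≡ φ(x) - φ(y) mod J^M_{x-y}`. -/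
theorem stmt13 (d s : ℕ) (hd : 1 ≤ d) (δ : ℝ) (hδ : 0 < δ) :
    ∃ p0 : ℕ, ∀ p : ℕ, p.Prime → p0 ≤ p →
    ∀ H : Finset (Fin d → ZMod p), δ * (p : ℝ) ^ d < (H.card : ℝ) →
    ∀ U : Submodule (ZMod p) (Fin d → ZMod p),
    ∀ (M : (Fin d → ZMod p) → ZMod p) (A : Matrix (Fin d) (Fin d) (ZMod p))
      (uu : Fin d → ZMod p) (vv : ZMod p),
      IsQuadFormWith p d M A uu vv → A.det ≠ 0 →
    ∀ C : (Fin d → ZMod p) → (Fin d → ZMod p) → MvPolynomial (Fin d) (ZMod p),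
      (∀ x ∈ H, ∀ y ∈ H, VecSubIndep p d ![x, y] U ⊥ → (C x y).IsHomogeneous s) →
      (∀ x ∈ H, ∀ y ∈ H, ∀ z ∈ H, VecSubIndep p d ![x, y, z] U ⊥ →
        C x y + C y z - C x z ∈
          JM p d A (Submodule.span (ZMod p) {x - y, y - z} : Set (Fin d → ZMod p))) →
      s + Module.finrank (ZMod p) U + 9 ≤ d →
      ∃ φ : (Fin d → ZMod p) → MvPolynomial (Fin d) (ZMod p),
        (∀ x ∈ H, VecSubIndep p d ![x] U ⊥ → (φ x).IsHomogeneous s) ∧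
        ∀ x ∈ H, ∀ y ∈ H, VecSubIndep p d ![x, y] U ⊥ →
          C x y - (φ x - φ y) ∈
            JM p d A (Submodule.span (ZMod p) {x - y} : Set (Fin d → ZMod p)) := by
  obtain ⟨N, hN⟩ := exists_nat_gt (1 / δ)
  refine ⟨max 3 N, ?_⟩
  intro p hpp hp0 H hH U M A uu vv hM hdet C hC1 hC2 hdim
  have : Fact p.Prime := ⟨hpp⟩
  have hp2 : p ≠ 2 := by have := le_of_max_le_left hp0; omega
  have hpδ : 1 ≤ δ * p := by
    have h1 : (N : ℝ) ≤ p := by exact_mod_cast le_of_max_le_right hp0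
    have h2 : 1 / δ ≤ p := hN.le.trans h1
    rw [div_le_iff₀ hδ] at h2
    linarith
  have hA := hM.1
  have hd9 : 9 ≤ d := by omega
  obtain ⟨z, hzH, hz⟩ := S13.exists_z hpδ H hd hH U (s + 5) (by omega)
  obtain ⟨ψ, hψ1, hψ2⟩ := S13.exists_psi hp2 hd9 A hA hdet H U C hC1 hC2 z hzH hz _ le_rfl
  have hφ : ∀ x, ∃ φ : MvPolynomial (Fin d) (ZMod p), x ∈ H → VecSubIndep p d ![x] U ⊥ →
      φ.IsHomogeneous s ∧ ∃ i0, ∀ i, i ≠ i0 → φ - (C x (z i) + ψ i) ∈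
        JM p d A (Submodule.span (ZMod p) {x - z i} : Set (Fin d → ZMod p)) := by
    intro x
    by_cases hx : x ∈ H ∧ VecSubIndep p d ![x] U ⊥
    · have hne : U.mkQ x ≠ 0 := by
        have := (S13.vsi _ _).1 hx.2
        exact this.ne_zero 0
      obtain ⟨i0, -, hi0⟩ := S13.exch hz ∅ (U.mkQ x) (by simpa using hne) ⟨0, by simp⟩
      obtain ⟨φ, h1, h2⟩ := S13.step hp2 hd9 A hA hdet H U C hC1 hC2 z hzH hz
        (Finset.univ.filter (fun i => i ≠ i0)) ψ hψ1
        (fun i _ j _ hji => hψ2 i j i.2 hji) x hx.1 (by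
          have hset : ((Finset.univ.filter (fun i => i ≠ i0) : Finset (Fin (s + 5))) :
              Set (Fin (s + 5))) = {i0}ᶜ := by ext i; simp
          rw [hset]; exact hi0)
      exact ⟨φ, fun _ _ => ⟨h1, i0, fun i hi => h2 i (by simpa using hi)⟩⟩
    · exact ⟨0, fun h1 h2 => absurd ⟨h1, h2⟩ hx⟩
  choose φ hφ using hφ
  refine ⟨φ, fun x hx hxi => (hφ x hx hxi).1, ?_⟩
  intro x hx y hy hxy
  have hli := (S13.vsi _ _).1 hxy
  have hx0 : U.mkQ x ≠ 0 := hli.ne_zero 0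
  have hy0 : U.mkQ y ≠ 0 := hli.ne_zero 1
  have hyx : U.mkQ y ∉ Submodule.span (ZMod p) {U.mkQ x} := by
    intro h
    obtain ⟨a, ha⟩ := Submodule.mem_span_singleton.1 h
    rw [Fintype.linearIndependent_iff] at hli
    have := hli ![a, -1] (by simp only [Fin.sum_univ_two, Matrix.cons_val]; rw [ha]; module) 1
    simp at this
  have hxs : VecSubIndep p d ![x] U ⊥ := by
    rw [S13.vsi, linearIndependent_unique_iff]; exact hx0
  have hys : VecSubIndep p d ![y] U ⊥ := by
    rw [S13.vsi, linearIndependent_unique_iff]; exact hy0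
  obtain ⟨hφx, ix, hix⟩ := hφ x hx hxs
  obtain ⟨hφy, iy, hiy⟩ := hφ y hy hys
  obtain ⟨i0, -, hi0⟩ := S13.exch hz ∅ (U.mkQ x) (by simpa using hx0) ⟨0, by simp⟩
  have hw := S13.upd hz i0 _ hi0
  obtain ⟨i1, hi10, hi1⟩ := S13.exch hw {i0} (U.mkQ y) (by simpa using hyx)
    (by
      by_cases h : i0 = 0
      · exact ⟨1, by subst h; simp [Fin.ext_iff]⟩
      · exact ⟨0, fun h' => h h'.symm⟩)
  have hi10 : i1 ≠ i0 := hi10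
  have hw2 := S13.upd hw i1 _ hi1
  set w2 := Function.update (Function.update (fun i => U.mkQ (z i)) i0 (U.mkQ x)) i1 (U.mkQ y)
    with hw2def
  have w0 : w2 i0 = U.mkQ x := by simp [hw2def, Function.update_of_ne hi10.symm]
  have w1 : w2 i1 = U.mkQ y := by simp [hw2def]
  have wi : ∀ i, i ≠ i0 → i ≠ i1 → w2 i = U.mkQ (z i) := by
    intro i h0 h1
    simp [hw2def, Function.update_of_ne h0, Function.update_of_ne h1]
  refine S13.keyK_hom hp2 hd9 A hA hdet (x - y) (fun i => y - z i) _
    (Finset.univ \ {ix, iy, i0, i1}) ?_ ?_ s ?_ ?_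
  · intro i hi j hj hij
    simp only [Finset.mem_sdiff, Finset.mem_univ, Finset.mem_insert, Finset.mem_singleton,
      not_or, true_and] at hi hj
    apply S13.ns2 U.mkQ
    have := hw2.comp ![i0, i1, i, j] (by
      rw [List.nodup_ofFn.symm]
      simp [hij, hi10.symm, Ne.symm hi.2.2.1, Ne.symm hi.2.2.2, Ne.symm hj.2.2.1,
        Ne.symm hj.2.2.2])
    refine S13.li_congr this (fun l => ?_)
    fin_cases l
    · exact w0.symm
    · exact w1.symm
    · exact (wi i hi.2.2.1 hi.2.2.2).symm
    · exact (wi j hj.2.2.1 hj.2.2.2).symm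
  · intro i hi
    simp only [Finset.mem_sdiff, Finset.mem_univ, Finset.mem_insert, Finset.mem_singleton,
      not_or, true_and] at hi
    have h1 := hC2 x hx y hy (z i) (hzH i) (by
      rw [S13.vsi]
      have := hw2.comp ![i0, i1, i] (by
        rw [List.nodup_ofFn.symm]
        simp [hi10.symm, Ne.symm hi.2.2.1, Ne.symm hi.2.2.2])
      refine S13.li_congr this (fun l => ?_)
      fin_cases l
      · exact w0.symm
      · exact w1.symm
      · exact (wi i hi.2.2.1 hi.2.2.2).symm)
    have hm1 : x - y ∈ Submodule.span (ZMod p) {x - y, y - z i} :=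
      Submodule.subset_span (Or.inl rfl)
    have hm2 : y - z i ∈ Submodule.span (ZMod p) {x - y, y - z i} :=
      Submodule.subset_span (Or.inr rfl)
    have h2 := S13.JM_span_mono A (T := {x - y, y - z i}) (by
      rintro v rfl
      have : x - z i = (x - y) + (y - z i) := by abel
      rw [this]
      exact Submodule.add_mem _ hm1 hm2) (hix i hi.1)
    have h3 := S13.JM_span_mono A (T := {x - y, y - z i}) (by
      rintro v rfl
      exact hm2) (hiy i hi.2.1)
    have := Ideal.add_mem _ (Ideal.sub_mem _ h1 h2) h3
    convert this using 1
    ring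
  · have h1 := Finset.le_card_sdiff ({ix, iy, i0, i1} : Finset (Fin (s + 5))) Finset.univ
    have h2 : ({ix, iy, i0, i1} : Finset (Fin (s + 5))).card ≤ 4 := Finset.card_le_four
    rw [Finset.card_univ, Fintype.card_fin] at h1
    omega
  · exact (hC1 x hx y hy hxy).sub (hφx.sub hφy)
end
end
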